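/- arXiv:2012.08964 — 2 statements merged into one kernel-verified Lean document; each statement's English description precedes it below -/
import Mathlib

section
/- Quantitative (p,q)-Theorem with small lower bound on p: There is a universal constant c > 0 such that for every dimension d ≥ 1 and every integer p ≥ 3d+1 there is an integer H = H(p,d) with the following property. Let 𝒞 be a finite family of convex sets in ℝ^d, each containing an ellipsoid of volume one, and assume that among any p members of 𝒞 there exist 3d+1 whose intersection contains an ellipsoid of volume one. Then there exists a finite family T of ellipsoids, each of volume v = c^(d²) · d^(−5d²/2 + d), with |T| ≤ H, such that every member of 𝒞 contains at least one ellipsoid from T. -/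
open MeasureTheory

/-- An ellipsoid is the image of the closed Euclidean unit ball under an
invertible affine transformation. -/
def IsEllipsoid {d : ℕ} (E : Set (EuclideanSpace ℝ (Fin d))) : Prop :=
  ∃ L : EuclideanSpace ℝ (Fin d) ≃ᵃ[ℝ] EuclideanSpace ℝ (Fin d),
    E = L '' Metric.closedBall 0 1

section ConvexGeometry

variable {E : Type*} [NormedAddCommGroup E] [InnerProductSpace ℝ E] [FiniteDimensional ℝ E]

theorem isCompact_convexHull_of_isCompact {s : Set E} (hs : IsCompact s) :
    IsCompact (convexHull ℝ s) := by
  have h : convexHull ℝ s = ⋃ k ∈ Finset.range (Module.finrank ℝ E + 2),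
      (fun p : (Fin k → ℝ) × (Fin k → E) => ∑ i, p.1 i • p.2 i) ''
        (stdSimplex ℝ (Fin k) ×ˢ Set.univ.pi fun _ => s) := by
    apply Set.Subset.antisymm
    · intro x hx
      obtain ⟨ι, _, z, w, hz, hai, hw, hw1, rfl⟩ := eq_pos_convex_span_of_mem_convexHull hx
      refine Set.mem_biUnion (x := Fintype.card ι) ?_ ?_
      · have := hai.card_le_finrank_succ
        have := Submodule.finrank_le (vectorSpan ℝ (Set.range z))
        simp only [Finset.coe_range, Set.mem_Iio]
        lia
      · let e := Fintype.equivFin ι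
        refine ⟨(w ∘ e.symm, z ∘ e.symm), ⟨⟨fun i => (hw _).le, ?_⟩, ?_⟩, ?_⟩
        · simpa using (Equiv.sum_comp e.symm w).trans hw1
        · exact fun i _ => hz ⟨_, rfl⟩
        · simpa using Equiv.sum_comp e.symm fun i => w i • z i
    · refine Set.iUnion₂_subset fun k _ => ?_
      rintro _ ⟨⟨w, z⟩, ⟨hw, hz⟩, rfl⟩
      exact mem_convexHull_of_exists_fintype w z hw.1 hw.2 (fun i => hz i trivial) rfl
  rw [h]
  refine Finset.isCompact_biUnion _ fun k _ => IsCompact.image ?_ (by fun_prop)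
  exact (isCompact_stdSimplex ℝ _).prod (isCompact_univ_pi fun _ => hs)

open Classical in
/-- A point of smallest norm in `K`, if there is one. -/
noncomputable def minNormPoint (K : Set E) : E :=
  if h : ∃ x ∈ K, ∀ y ∈ K, ‖x‖ ≤ ‖y‖ then h.choose else 0

theorem minNormPoint_spec {K : Set E} (hK : IsClosed K) (hne : K.Nonempty) :
    minNormPoint K ∈ K ∧ ∀ y ∈ K, ‖minNormPoint K‖ ≤ ‖y‖ := by
  have h : ∃ x ∈ K, ∀ y ∈ K, ‖x‖ ≤ ‖y‖ := by
    obtain ⟨x, hx, hxd⟩ := hK.exists_infDist_eq_dist hne 0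
    refine ⟨x, hx, fun y hy => ?_⟩
    have := Metric.infDist_le_dist_of_mem (x := (0 : E)) hy
    simpa [hxd] using this
  rw [minNormPoint, dif_pos h]
  exact h.choose_spec

/-- The point of smallest norm of an intersection of `dim E + 1` convex sets is already determined
by all but one of them. -/
theorem exists_minNormPoint_erase_mem {ι : Type*} [DecidableEq ι] {s : Finset ι} {K : ι → Set E}
    (hs : s.card = Module.finrank ℝ E + 1) (hconv : ∀ i, Convex ℝ (K i))
    (hclosed : ∀ i, IsClosed (K i)) (hne : (⋂ i ∈ s, K i).Nonempty) :
    ∃ i ∈ s, minNormPoint (⋂ j ∈ s.erase i, K j) ∈ K i := by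
  by_contra! hcon
  have hcl (t : Finset ι) : IsClosed (⋂ i ∈ t, K i) :=
    isClosed_biInter fun i _ => hclosed i
  obtain ⟨hx, hxmin⟩ := minNormPoint_spec (hcl s) hne
  set x := minNormPoint (⋂ i ∈ s, K i)
  let F : Option ι → Set E := fun o => o.elim (Metric.ball 0 ‖x‖) K
  have key : (⋂ o ∈ Finset.insertNone s, F o).Nonempty := by
    refine Convex.helly_theorem' (𝕜 := ℝ) ?_ ?_
    · rintro (_ | i) _
      · exact convex_ball _ _
      · exact hconv i
    · intro I hI hIc
      by_cases hnone : none ∈ I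
      · obtain ⟨i, his, hiI⟩ : ∃ i ∈ s, some i ∉ I := by
          by_contra! hall
          have : Finset.insertNone s ⊆ I := by
            rintro (_ | i) hi
            · exact hnone
            · exact hall i (by simpa using hi)
          have := Finset.card_le_card this
          rw [Finset.card_insertNone] at this
          lia
        have hx' : x ∈ ⋂ j ∈ s.erase i, K j := by
          simp only [Set.mem_iInter] at hx ⊢
          exact fun j hj => hx j (Finset.mem_of_mem_erase hj)
        obtain ⟨hy, hymin⟩ := minNormPoint_spec (hcl (s.erase i)) ⟨x, hx'⟩
        set y := minNormPoint (⋂ j ∈ s.erase i, K j)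
        have hxy : x ≠ y := by
          intro h
          apply hcon i his
          change y ∈ K i
          rw [← h]
          exact Set.mem_iInter₂.1 hx i his
        refine ⟨(1 / 2 : ℝ) • x + (1 / 2 : ℝ) • y, ?_⟩
        have hm : (1 / 2 : ℝ) • x + (1 / 2 : ℝ) • y ∈ ⋂ j ∈ s.erase i, K j :=
          (convex_iInter₂ fun j _ => hconv j) hx' hy (by norm_num) (by norm_num) (by norm_num)
        refine Set.mem_iInter₂.2 ?_
        rintro (_ | j) hj
        · simpa [F] using norm_combo_lt_of_ne le_rfl (hymin x hx') hxy
            (by norm_num : (0 : ℝ) < 1 / 2) (by norm_num : (0 : ℝ) < 1 / 2) (by norm_num)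
        · refine Set.mem_iInter₂.1 hm j (Finset.mem_erase.2 ⟨?_, by simpa using hI hj⟩)
          rintro rfl
          exact hiI hj
      · refine ⟨x, Set.mem_iInter₂.2 ?_⟩
        rintro (_ | j) hj
        · exact absurd hj hnone
        · exact Set.mem_iInter₂.1 hx j (by simpa using hI hj)
  obtain ⟨z, hz⟩ := key
  have hz' := Set.mem_iInter₂.1 hz
  have h1 : z ∈ ⋂ i ∈ s, K i :=
    Set.mem_iInter₂.2 fun i hi => hz' (some i) (by simpa using hi)
  have h2 : ‖z‖ < ‖x‖ := by simpa [F] using hz' none (by simp)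
  exact absurd (hxmin z h1) h2.not_ge

/-- A weak form of Tverberg's theorem. -/
theorem exists_disjoint_convexHull_inter {ι : Type*} [Fintype ι] [DecidableEq ι] (y : ι → E)
    (hι : Fintype.card ι = (Module.finrank ℝ E + 1) ^ 3) :
    ∃ 𝒮 : Finset (Finset ι), 𝒮.card = Module.finrank ℝ E + 1 ∧
      (∀ S ∈ 𝒮, S.Nonempty) ∧ (∀ S ∈ 𝒮, ∀ T ∈ 𝒮, S ≠ T → Disjoint S T) ∧
      (⋂ S ∈ 𝒮, convexHull ℝ (y '' (S : Set ι))).Nonempty := by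
  set D := Module.finrank ℝ E with hD
  obtain ⟨x, hx⟩ : (⋂ S ∈ Finset.univ.filter (fun S : Finset ι => Sᶜ.card ≤ D * (D + 1)),
      convexHull ℝ (y '' (S : Set ι))).Nonempty := by
    refine Convex.helly_theorem' (𝕜 := ℝ) (fun _ _ => convex_convexHull _ _) ?_
    intro I hI hIc
    have hcard : (I.biUnion fun S => Sᶜ).card < Fintype.card ι := by
      calc (I.biUnion fun S => Sᶜ).card ≤ I.card * (D * (D + 1)) :=
            Finset.card_biUnion_le_card_mul _ _ _ fun S hS => by simpa using hI hS
        _ ≤ (D + 1) * (D * (D + 1)) := Nat.mul_le_mul_right _ hIc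
        _ < (D + 1) ^ 3 := by nlinarith
        _ = _ := hι.symm
    obtain ⟨i, hi⟩ : ∃ i, i ∉ I.biUnion fun S => Sᶜ := by
      by_contra! h
      rw [Finset.eq_univ_iff_forall.2 h, Finset.card_univ] at hcard
      exact lt_irrefl _ hcard
    refine ⟨y i, Set.mem_iInter₂.2 fun S hS => subset_convexHull _ _ ⟨i, ?_, rfl⟩⟩
    simp only [Finset.mem_biUnion, Finset.mem_compl, not_exists, not_and, not_not] at hi
    exact hi S hS
  have hx' : ∀ S : Finset ι, Sᶜ.card ≤ D * (D + 1) → x ∈ convexHull ℝ (y '' (S : Set ι)) :=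
    fun S hS => Set.mem_iInter₂.1 hx S (by simpa using hS)
  have step : ∀ k ≤ D + 1, ∃ 𝒮 : Finset (Finset ι), 𝒮.card = k ∧
      (∀ S ∈ 𝒮, S.card ≤ D + 1 ∧ S.Nonempty ∧ x ∈ convexHull ℝ (y '' (S : Set ι))) ∧
      (∀ S ∈ 𝒮, ∀ T ∈ 𝒮, S ≠ T → Disjoint S T) := by
    intro k
    induction k with
    | zero => exact fun _ => ⟨∅, by simp⟩
    | succ k ih =>
      intro hk
      obtain ⟨𝒮, hc, h𝒮, hdis⟩ := ih (by lia)
      have hU : (𝒮.biUnion id).card ≤ D * (D + 1) :=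
        (Finset.card_biUnion_le_card_mul _ _ _ fun S hS => (h𝒮 S hS).1).trans
          (Nat.mul_le_mul_right _ (by lia))
      have hxU := hx' (𝒮.biUnion id)ᶜ (by rwa [compl_compl])
      rw [convexHull_eq_union] at hxU
      simp only [Set.mem_iUnion, exists_prop] at hxU
      obtain ⟨t, hts, hai, hxt⟩ := hxU
      have : Nonempty ι := Fintype.card_pos_iff.1 (by rw [hι]; positivity)
      have hpre : ∀ e ∈ t, ∃ a, a ∈ ((𝒮.biUnion id)ᶜ : Finset ι) ∧ y a = e := fun e he => hts he
      choose! g hgU hg using hpre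
      have htc : t.card ≤ D + 1 := by
        have h1 := hai.card_le_finrank_succ
        have h2 := Submodule.finrank_le (vectorSpan ℝ (Set.range ((↑) : t → E)))
        rw [Fintype.card_coe] at h1
        lia
      have himg : y '' ((t.image g : Finset ι) : Set ι) = t := by
        ext e
        simp only [Finset.coe_image, Set.mem_image, SetLike.mem_coe, exists_exists_and_eq_and]
        constructor
        · rintro ⟨a, ha, rfl⟩
          rwa [hg a ha]
        · exact fun he => ⟨e, he, hg e he⟩
      have hne : (t.image g).Nonempty := by
        rw [Finset.image_nonempty, Finset.nonempty_iff_ne_empty]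
        rintro rfl
        simp at hxt
      have hdisj : ∀ T ∈ 𝒮, Disjoint (t.image g) T := by
        intro T hT
        rw [Finset.disjoint_left]
        rintro a ha haT
        obtain ⟨e, he, rfl⟩ := Finset.mem_image.1 ha
        have := hgU e he
        simp only [Finset.mem_compl, Finset.mem_biUnion, id, not_exists, not_and] at this
        exact this T hT haT
      have hnotin : t.image g ∉ 𝒮 := fun h => hne.ne_empty (by simpa using hdisj _ h)
      refine ⟨insert (t.image g) 𝒮, by rw [Finset.card_insert_of_notMem hnotin, hc], ?_, ?_⟩
      · simp only [Finset.mem_insert, forall_eq_or_imp]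
        exact ⟨⟨Finset.card_image_le.trans htc, hne, by rwa [himg]⟩, h𝒮⟩
      · simp only [Finset.mem_insert]
        rintro S (rfl | hS) T (rfl | hT) hST
        · exact absurd rfl hST
        · exact hdisj T hT
        · exact (hdisj S hS).symm
        · exact hdis S hS T hT hST
  obtain ⟨𝒮, hc, h𝒮, hdis⟩ := step (D + 1) le_rfl
  exact ⟨𝒮, hc, fun S hS => (h𝒮 S hS).2.1, hdis, x,
    Set.mem_iInter₂.2 fun S hS => (h𝒮 S hS).2.2⟩

end ConvexGeometry

section Averaging

variable {Ω ι : Type*} [Fintype Ω] [Fintype ι] [DecidableEq ι]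

theorem sum_prod_eq_one {w : Ω → ℝ} (hw1 : ∑ ω, w ω = 1) :
    ∑ f : ι → Ω, ∏ i, w (f i) = 1 := by
  rw [← Fintype.prod_sum fun (_ : ι) ω => w ω]
  simp [hw1]

theorem sum_prod_mul_apply {w : Ω → ℝ} (hw1 : ∑ ω, w ω = 1) (j : ι) (h : Ω → ℝ) :
    ∑ f : ι → Ω, (∏ i, w (f i)) * h (f j) = ∑ ω, w ω * h ω := by
  have key := Fintype.prod_sum fun (i : ι) ω => w ω * if i = j then h ω else 1
  rw [Finset.prod_eq_single j (fun i _ hi => by simp [hi, hw1]) (by simp)] at key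
  simp only [if_true] at key
  rw [key]
  refine Finset.sum_congr rfl fun f _ => ?_
  rw [Finset.prod_mul_distrib, Finset.prod_ite_eq' Finset.univ j]
  simp

/-- Resampling the coordinates in `V` does not change averages over product weights. -/
theorem sum_sum_piecewise {w : Ω → ℝ} (hw1 : ∑ ω, w ω = 1) (V : Finset ι) (G : (ι → Ω) → ℝ) :
    ∑ f : ι → Ω, (∏ i, w (f i)) * ∑ g : ι → Ω, (∏ i, w (g i)) * G (V.piecewise g f) =
      ∑ f : ι → Ω, (∏ i, w (f i)) * G f := by
  let e : (ι → Ω) × (ι → Ω) ≃ (ι → Ω) × (ι → Ω) :=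
    { toFun := fun p => (V.piecewise p.2 p.1, V.piecewise p.1 p.2)
      invFun := fun p => (V.piecewise p.2 p.1, V.piecewise p.1 p.2)
      left_inv := fun p => by
        ext i <;> by_cases hi : i ∈ V <;> simp [hi]
      right_inv := fun p => by
        ext i <;> by_cases hi : i ∈ V <;> simp [hi] }
  have hprod (p : (ι → Ω) × (ι → Ω)) : (∏ i, w (p.1 i)) * ∏ i, w (p.2 i) =
      (∏ i, w ((e p).1 i)) * ∏ i, w ((e p).2 i) := by
    rw [← Finset.prod_mul_distrib, ← Finset.prod_mul_distrib]
    refine Finset.prod_congr rfl fun i _ => ?_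
    by_cases hi : i ∈ V <;> simp [e, hi, mul_comm]
  calc _ = ∑ p : (ι → Ω) × (ι → Ω),
        ((∏ i, w (p.1 i)) * ∏ i, w (p.2 i)) * G (V.piecewise p.2 p.1) := by
        rw [Fintype.sum_prod_type]
        simp only [Finset.mul_sum, mul_assoc]
    _ = ∑ p : (ι → Ω) × (ι → Ω), ((∏ i, w ((e p).1 i)) * ∏ i, w ((e p).2 i)) * G (e p).1 :=
        Finset.sum_congr rfl fun p _ => by rw [hprod p]; rfl
    _ = ∑ p : (ι → Ω) × (ι → Ω), ((∏ i, w (p.1 i)) * ∏ i, w (p.2 i)) * G p.1 :=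
        Equiv.sum_comp e fun p => ((∏ i, w (p.1 i)) * ∏ i, w (p.2 i)) * G p.1
    _ = _ := by
        rw [Fintype.sum_prod_type]
        refine Finset.sum_congr rfl fun f _ => ?_
        have h1 := sum_prod_eq_one (ι := ι) hw1
        calc ∑ g : ι → Ω, ((∏ i, w (f i)) * ∏ i, w (g i)) * G f
            = ((∏ i, w (f i)) * G f) * ∑ g : ι → Ω, ∏ i, w (g i) := by
              rw [Finset.mul_sum]
              exact Finset.sum_congr rfl fun g _ => by ring
          _ = _ := by rw [h1, mul_one]

theorem exists_le_of_weighted_sum {α : Type*} [Fintype α] {W F : α → ℝ} {c : ℝ}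
    (hW0 : ∀ a, 0 ≤ W a) (hW1 : ∑ a, W a = 1) (h : c ≤ ∑ a, W a * F a) : ∃ a, c ≤ F a := by
  by_contra! hlt
  obtain ⟨a, ha⟩ : ∃ a, 0 < W a := by
    by_contra! h0
    have := Finset.sum_nonpos fun a (_ : a ∈ Finset.univ) => h0 a
    linarith
  have : ∑ a, W a * F a < ∑ a, W a * c :=
    Finset.sum_lt_sum (fun a _ => mul_le_mul_of_nonneg_left (hlt a).le (hW0 a))
      ⟨a, Finset.mem_univ _, mul_lt_mul_of_pos_left (hlt a) ha⟩
  rw [← Finset.sum_mul, hW1] at this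
  linarith

open Classical in
/-- A minimax statement: if every weighting of the sets admits a point of mass `β`, then some
weighting of finitely many points gives each set mass `β`. -/
theorem exists_weights_of_forall_weights {E : Type*} [Nonempty E] {n : ℕ} (K : Fin n → Set E) {β : ℝ}
    (h : ∀ w : Fin n → ℝ, (∀ i, 0 ≤ w i) → ∑ i, w i = 1 →
      ∃ x, β ≤ ∑ i, w i * if x ∈ K i then 1 else 0) :
    ∃ (X : Type) (_ : Fintype X) (w : X → ℝ) (q : X → E), (∀ a, 0 ≤ w a) ∧ ∑ a, w a = 1 ∧
      ∀ i, β ≤ ∑ a, w a * if q a ∈ K i then 1 else 0 := by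
  let ind : E → Fin n → ℝ := fun x i => if x ∈ K i then 1 else 0
  have hfin : (Set.range ind).Finite := by
    refine (Set.Finite.pi' (t := fun _ : Fin n => ({0, 1} : Set ℝ)) fun _ => by simp).subset ?_
    rintro _ ⟨x, rfl⟩ i
    by_cases hx : x ∈ K i <;> simp [ind, hx]
  by_cases hdis : Disjoint (convexHull ℝ (Set.range ind)) {y | ∀ i, β ≤ y i}
  · exfalso
    have hBconv : Convex ℝ {y : Fin n → ℝ | ∀ i, β ≤ y i} := by
      intro y hy z hz a b ha hb hab i
      have h1 := mul_le_mul_of_nonneg_left (hy i) ha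
      have h2 := mul_le_mul_of_nonneg_left (hz i) hb
      calc β = a * β + b * β := by rw [← add_mul, hab, one_mul]
        _ ≤ a * y i + b * z i := add_le_add h1 h2
    have hBclosed : IsClosed {y : Fin n → ℝ | ∀ i, β ≤ y i} := by
      simp only [Set.ofPred_forall]
      exact isClosed_iInter fun i => isClosed_le continuous_const (continuous_apply i)
    obtain ⟨φ, u, v, hu, huv, hv⟩ := geometric_hahn_banach_compact_closed (convex_convexHull ℝ _)
      (hfin.isCompact_convexHull ℝ) hBconv hBclosed hdis
    set a : Fin n → ℝ := fun i => φ (Pi.single i 1) with ha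
    have hφ : ∀ y, φ y = ∑ i, a i * y i := by
      intro y
      conv_lhs => rw [← Finset.univ_sum_single y]
      rw [map_sum]
      refine Finset.sum_congr rfl fun i _ => ?_
      rw [mul_comm, ha, ← smul_eq_mul, ← map_smul, ← Pi.single_smul, smul_eq_mul, mul_one]
    have ha0 : ∀ i, 0 ≤ a i := by
      intro i
      by_contra! hneg
      obtain ⟨t, ht0, ht⟩ : ∃ t : ℝ, 0 ≤ t ∧ φ (fun _ => β) + t * a i ≤ v := by
        refine ⟨|(φ (fun _ => β) - v) / a i|, abs_nonneg _, ?_⟩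
        have h1 : (φ (fun _ => β) - v) / a i * a i = φ (fun _ => β) - v :=
          div_mul_cancel₀ _ hneg.ne
        have h2 := neg_abs_le ((φ (fun _ => β) - v) / a i)
        nlinarith
      have := hv ((fun _ => β) + t • Pi.single i 1) (by
        intro j
        by_cases hj : j = i
        · subst hj; simp [ht0]
        · simp [hj])
      rw [map_add, map_smul, smul_eq_mul] at this
      linarith
    have hasum : 0 < ∑ i, a i := by
      refine (Finset.sum_nonneg fun i _ => ha0 i).lt_of_ne' fun h0 => ?_
      have h0' : ∀ i, a i = 0 := fun i =>
        (Finset.sum_eq_zero_iff_of_nonneg fun i _ => ha0 i).1 h0 i (Finset.mem_univ i)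
      have h1 := hu _ (subset_convexHull ℝ _ ⟨Classical.arbitrary E, rfl⟩)
      have h2 := hv (fun _ => β) fun _ => le_rfl
      simp only [hφ, h0', zero_mul, Finset.sum_const_zero] at h1 h2
      linarith
    obtain ⟨x, hx⟩ := h (fun i => a i / ∑ i, a i) (fun i => div_nonneg (ha0 i) hasum.le)
      (by rw [← Finset.sum_div, div_self hasum.ne'])
    have h1 := hu _ (subset_convexHull ℝ _ ⟨x, rfl⟩)
    have h2 := hv (fun _ => β) fun _ => le_rfl
    rw [hφ] at h1 h2
    have h3 : ∑ i, a i / (∑ i, a i) * (if x ∈ K i then 1 else 0) =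
        (∑ i, a i * ind x i) / ∑ i, a i := by
      rw [Finset.sum_div]
      exact Finset.sum_congr rfl fun i _ => by rw [div_mul_eq_mul_div]
    rw [h3, le_div_iff₀ hasum] at hx
    rw [← Finset.sum_mul] at h2
    linarith
  · obtain ⟨y, hy, hyB⟩ := Set.not_disjoint_iff.1 hdis
    obtain ⟨X, hX, w, z, hw0, hw1, hz, rfl⟩ := mem_convexHull_iff_exists_fintype.1 hy
    choose q hq using hz
    refine ⟨X, hX, w, q, hw0, hw1, fun i => (hyB i).trans (le_of_eq ?_)⟩
    rw [Finset.sum_apply]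
    exact Finset.sum_congr rfl fun a _ => by rw [← hq a]; rfl

end Averaging

section FractionalHelly

variable {E : Type*} [NormedAddCommGroup E] [InnerProductSpace ℝ E] [FiniteDimensional ℝ E]

open Classical in
/-- A fractional Helly theorem for convex sets `K S f` depending on a random sequence `f` only
through the coordinates in `S`. -/
theorem fractional_helly_blocks {Ω ι : Type*} [Fintype Ω] [Fintype ι] [DecidableEq ι] {w : Ω → ℝ}
    (hw0 : ∀ ω, 0 ≤ w ω) (hw1 : ∑ ω, w ω = 1) (K : Finset ι → (ι → Ω) → Set E)
    (hconv : ∀ S f, Convex ℝ (K S f)) (hclosed : ∀ S f, IsClosed (K S f))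
    (hloc : ∀ S f g, (∀ i ∈ S, f i = g i) → K S f = K S g)
    (hint : ∀ f, ∃ 𝒮 : Finset (Finset ι), 𝒮.card = Module.finrank ℝ E + 1 ∧
      (∀ S ∈ 𝒮, S.Nonempty) ∧ (∀ S ∈ 𝒮, ∀ T ∈ 𝒮, S ≠ T → Disjoint S T) ∧
      (⋂ S ∈ 𝒮, K S f).Nonempty) :
    ∃ V : Finset ι, V.Nonempty ∧ ∃ x : E,
      1 / (Fintype.card (Finset (Finset ι) × Finset ι) : ℝ) ≤
        ∑ g : ι → Ω, (∏ i, w (g i)) * if x ∈ K V g then 1 else 0 := by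
  let A : Finset (Finset ι) × Finset ι → (ι → Ω) → Prop := fun p f =>
    p.2.Nonempty ∧ (∀ S ∈ p.1, Disjoint S p.2) ∧ minNormPoint (⋂ S ∈ p.1, K S f) ∈ K p.2 f
  have hA : ∀ f, ∃ p, A p f := by
    intro f
    obtain ⟨𝒮, hc, hne, hdis, hi⟩ := hint f
    obtain ⟨V, hV, hmem⟩ := exists_minNormPoint_erase_mem hc (fun S => hconv S f)
      (fun S => hclosed S f) hi
    exact ⟨(𝒮.erase V, V), hne V hV, fun S hS =>
      hdis S (Finset.mem_of_mem_erase hS) V hV (Finset.ne_of_mem_erase hS), hmem⟩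
  have hW0 : ∀ f : ι → Ω, 0 ≤ ∏ i, w (f i) := fun f => Finset.prod_nonneg fun i _ => hw0 _
  have hsum : (1 : ℝ) ≤ ∑ p, ∑ f : ι → Ω, (∏ i, w (f i)) * if A p f then 1 else 0 := by
    rw [Finset.sum_comm]
    refine (sum_prod_eq_one (ι := ι) hw1).symm.le.trans (Finset.sum_le_sum fun f _ => ?_)
    obtain ⟨p, hp⟩ := hA f
    rw [← Finset.mul_sum]
    refine le_mul_of_one_le_right (hW0 f) ?_
    calc (1 : ℝ) = if A p f then 1 else 0 := by rw [if_pos hp]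
      _ ≤ _ := Finset.single_le_sum (f := fun p => if A p f then (1 : ℝ) else 0)
        (fun q _ => by split_ifs <;> norm_num) (Finset.mem_univ p)
  set N := Fintype.card (Finset (Finset ι) × Finset ι) with hN
  have hNpos : 0 < (N : ℝ) := by exact_mod_cast Fintype.card_pos
  obtain ⟨p, -, hp⟩ : ∃ p ∈ (Finset.univ : Finset (Finset (Finset ι) × Finset ι)),
      1 / (N : ℝ) ≤ ∑ f : ι → Ω, (∏ i, w (f i)) * if A p f then 1 else 0 := by
    refine Finset.exists_le_of_sum_le Finset.univ_nonempty ?_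
    rw [Finset.sum_const, Finset.card_univ, ← hN, nsmul_eq_mul, mul_one_div_cancel hNpos.ne']
    exact hsum
  rw [← sum_sum_piecewise hw1 p.2] at hp
  obtain ⟨f, hf⟩ := exists_le_of_weighted_sum hW0 (sum_prod_eq_one hw1) hp
  obtain ⟨g, hg⟩ : ∃ g, A p (p.2.piecewise g f) := by
    by_contra! hno
    simp only [hno, if_false, mul_zero, Finset.sum_const_zero] at hf
    exact absurd hf (not_le.2 (by positivity))
  refine ⟨p.2, hg.1, minNormPoint (⋂ S ∈ p.1, K S f), hf.trans (le_of_eq ?_)⟩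
  refine Finset.sum_congr rfl fun h _ => ?_
  have h1 : ∀ S ∈ p.1, K S (p.2.piecewise h f) = K S f := fun S hS =>
    hloc S _ _ fun i hi => Finset.piecewise_eq_of_notMem _ _ _
      (Finset.disjoint_left.1 (hg.2.1 S hS) hi)
  have h2 : K p.2 (p.2.piecewise h f) = K p.2 h :=
    hloc _ _ _ fun i hi => Finset.piecewise_eq_of_mem _ _ _ hi
  have h3 : A p (p.2.piecewise h f) ↔ minNormPoint (⋂ S ∈ p.1, K S f) ∈ K p.2 h := by
    simp only [A, h2, Set.iInter₂_congr h1, hg.1, true_and]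
    exact ⟨fun h => h.2, fun h => ⟨hg.2.1, h⟩⟩
  simp only [h3]

open Classical in
/-- A weighted fractional Helly theorem for finite families satisfying a `(P, dim E + 1)`
condition for sequences. -/
theorem fractional_helly_weighted (P : ℕ) :
    ∃ β : ℝ, 0 < β ∧ ∀ {Ω : Type} [Fintype Ω] (w : Ω → ℝ), (∀ ω, 0 ≤ w ω) → ∑ ω, w ω = 1 →
      ∀ K : Ω → Set E, (∀ ω, Convex ℝ (K ω)) →
      (∀ f : Fin P → Ω, ∃ S : Finset (Fin P), S.card = Module.finrank ℝ E + 1 ∧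
        (⋂ j ∈ S, K (f j)).Nonempty) →
      ∃ x, β ≤ ∑ ω, w ω * if x ∈ K ω then 1 else 0 := by
  refine ⟨1 / (Fintype.card (Finset (Finset (Fin P)) × Finset (Fin P)) : ℝ),
    one_div_pos.2 (by exact_mod_cast Fintype.card_pos), ?_⟩
  intro Ω _ w hw0 hw1 K hK hint
  let pt : Finset Ω → E := fun I => if h : (⋂ ω ∈ I, K ω).Nonempty then h.choose else 0
  have hpt : ∀ I, (⋂ ω ∈ I, K ω).Nonempty → ∀ ω ∈ I, pt I ∈ K ω := by
    intro I h ω hω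
    simp only [pt, dif_pos h]
    exact Set.mem_iInter₂.1 h.choose_spec ω hω
  let K' : Ω → Set E := fun ω =>
    convexHull ℝ (pt '' {I | ω ∈ I ∧ (⋂ ω ∈ I, K ω).Nonempty})
  have hK'K : ∀ ω, K' ω ⊆ K ω := by
    intro ω
    refine convexHull_min ?_ (hK ω)
    rintro _ ⟨I, ⟨hω, hI⟩, rfl⟩
    exact hpt I hI ω hω
  obtain ⟨V, ⟨j, hj⟩, x, hx⟩ := fractional_helly_blocks hw0 hw1
    (fun (S : Finset (Fin P)) f => ⋂ j ∈ S, K' (f j))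
    (fun S f => convex_iInter₂ fun _ _ => convex_convexHull _ _)
    (fun S f => isClosed_biInter fun _ _ => ((Set.toFinite _).image _).isClosed_convexHull ℝ)
    (fun S f g hfg => Set.iInter₂_congr fun j hj => by rw [hfg j hj])
    (fun f => by
      obtain ⟨S, hS, hne⟩ := hint f
      refine ⟨S.image fun j => {j}, ?_, ?_, ?_, ?_⟩
      · rw [Finset.card_image_of_injective _ Finset.singleton_injective, hS]
      · simp
      · simp only [Finset.mem_image]
        rintro _ ⟨i, -, rfl⟩ _ ⟨j, -, rfl⟩ hij
        rw [Finset.disjoint_singleton]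
        rintro rfl
        exact hij rfl
      · have hI : (⋂ ω ∈ S.image f, K ω).Nonempty := by
          simpa [Set.Nonempty] using hne
        refine ⟨pt (S.image f), ?_⟩
        simp only [Finset.mem_image, Set.mem_iInter]
        rintro _ ⟨i, hi, rfl⟩ j hj
        obtain rfl := Finset.mem_singleton.1 hj
        exact subset_convexHull _ _ ⟨_, ⟨Finset.mem_image_of_mem f hi, hI⟩, rfl⟩)
  refine ⟨x, hx.trans ?_⟩
  rw [← sum_prod_mul_apply hw1 j fun ω => if x ∈ K ω then 1 else 0]
  refine Finset.sum_le_sum fun g _ => ?_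
  refine mul_le_mul_of_nonneg_left ?_ (Finset.prod_nonneg fun i _ => hw0 _)
  by_cases hxg : x ∈ ⋂ j ∈ V, K' (g j)
  · rw [if_pos hxg, if_pos (hK'K _ (Set.mem_iInter₂.1 hxg j hj))]
  · rw [if_neg hxg]
    split_ifs <;> norm_num

open Classical in
/-- The first selection lemma, for hulls of boundedly many random points. -/
theorem exists_mem_convexHull_range :
    ∃ (M : ℕ) (c : ℝ), 0 < c ∧ ∀ {X : Type} [Fintype X] (w : X → ℝ), (∀ a, 0 ≤ w a) →
      ∑ a, w a = 1 → ∀ q : X → E, ∃ x,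
        c ≤ ∑ g : Fin M → X, (∏ i, w (g i)) *
          if x ∈ convexHull ℝ (Set.range (q ∘ g)) then 1 else 0 := by
  obtain ⟨M, hM⟩ : ∃ M, M = (Module.finrank ℝ E + 1) ^ 3 := ⟨_, rfl⟩
  refine ⟨M, 1 / (Fintype.card (Finset (Finset (Fin M)) × Finset (Fin M)) : ℝ),
    one_div_pos.2 (by exact_mod_cast Fintype.card_pos), ?_⟩
  intro X _ w hw0 hw1 q
  obtain ⟨V, -, x, hx⟩ := fractional_helly_blocks hw0 hw1
    (fun (S : Finset (Fin M)) f => convexHull ℝ ((q ∘ f) '' (S : Set (Fin M))))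
    (fun S f => convex_convexHull _ _)
    (fun S f => ((Set.toFinite _).image _).isClosed_convexHull ℝ)
    (fun S f g hfg => by
      refine congrArg _ (Set.image_congr fun j hj => ?_)
      simp [hfg j hj])
    (fun f => exists_disjoint_convexHull_inter (q ∘ f) (by simp [hM]))
  refine ⟨x, hx.trans (Finset.sum_le_sum fun g _ => ?_)⟩
  refine mul_le_mul_of_nonneg_left ?_ (Finset.prod_nonneg fun i _ => hw0 _)
  by_cases hxg : x ∈ convexHull ℝ ((q ∘ g) '' (V : Set (Fin M)))
  · rw [if_pos hxg, if_pos (convexHull_mono (Set.image_subset_range _ _) hxg)]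
  · rw [if_neg hxg]
    split_ifs <;> norm_num

open Classical in
/-- Weak `β`-nets for convex sets. -/
theorem exists_weak_net {β : ℝ} (hβ : 0 < β) :
    ∃ N : ℕ, ∀ {X : Type} [Fintype X] (w : X → ℝ), (∀ a, 0 ≤ w a) → ∑ a, w a = 1 →
      ∀ (q : X → E) {n : ℕ} (K : Fin n → Set E), (∀ i, Convex ℝ (K i)) →
      (∀ i, β ≤ ∑ a, w a * if q a ∈ K i then 1 else 0) →
      ∃ T : Finset E, T.card ≤ N ∧ ∀ i, ∃ x ∈ T, x ∈ K i := by
  obtain ⟨M, c, hc, hsel⟩ := exists_mem_convexHull_range (E := E)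
  refine ⟨⌈1 / (c * β ^ M)⌉₊, ?_⟩
  intro X _ w hw0 hw1 q n K hK hmass
  have hW0 : ∀ g : Fin M → X, 0 ≤ ∏ j, w (g j) := fun g => Finset.prod_nonneg fun j _ => hw0 _
  have hpt : ∀ i, ∃ x, c * β ^ M ≤ ∑ g : Fin M → X, if (∀ j, q (g j) ∈ K i) ∧
      x ∈ convexHull ℝ (Set.range (q ∘ g)) then ∏ j, w (g j) else 0 := by
    intro i
    set m := ∑ a, w a * if q a ∈ K i then (1 : ℝ) else 0 with hm
    have hm0 : 0 < m := hβ.trans_le (hmass i)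
    obtain ⟨x, hx⟩ := hsel (fun a => (w a * if q a ∈ K i then 1 else 0) / m)
      (fun a => div_nonneg (mul_nonneg (hw0 a) (by split_ifs <;> norm_num)) hm0.le)
      (by rw [← Finset.sum_div, ← hm, div_self hm0.ne']) q
    refine ⟨x, ?_⟩
    calc c * β ^ M ≤ c * m ^ M := by gcongr; exact hmass i
      _ ≤ (∑ g : Fin M → X, (∏ j, (w (g j) * if q (g j) ∈ K i then 1 else 0) / m) *
          if x ∈ convexHull ℝ (Set.range (q ∘ g)) then 1 else 0) * m ^ M := by gcongr
      _ = _ := by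
        rw [Finset.sum_mul]
        refine Finset.sum_congr rfl fun g _ => ?_
        rw [Finset.prod_div_distrib, Finset.prod_const, Finset.card_univ, Fintype.card_fin,
          Finset.prod_mul_distrib, Finset.prod_ite_zero]
        have : m ^ M ≠ 0 := by positivity
        by_cases h1 : ∀ j, q (g j) ∈ K i <;>
          by_cases h2 : x ∈ convexHull ℝ (Set.range (q ∘ g)) <;> simp [h1, h2, this]
  choose x hx using hpt
  let A : Fin n → Finset (Fin M → X) := fun i => Finset.univ.filter fun g =>
    (∀ j, q (g j) ∈ K i) ∧ x i ∈ convexHull ℝ (Set.range (q ∘ g))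
  have hA : ∀ i, c * β ^ M ≤ ∑ g ∈ A i, ∏ j, w (g j) := by
    intro i
    rw [Finset.sum_filter]
    exact hx i
  have hcβ : 0 < c * β ^ M := by positivity
  have hAK : ∀ i s, ∀ g ∈ A i, g ∈ A s → x s ∈ K i := by
    intro i s g hgi hgs
    simp only [A, Finset.mem_filter, Finset.mem_univ, true_and] at hgi hgs
    refine convexHull_min ?_ (hK i) hgs.2
    rintro _ ⟨j, rfl⟩
    exact hgi.1 j
  obtain ⟨I, hI, hImax⟩ := Finset.exists_max_image
    (Finset.univ.filter fun I : Finset (Fin n) => (I : Set (Fin n)).PairwiseDisjoint A)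
    Finset.card ⟨∅, by simp⟩
  simp only [Finset.mem_filter, Finset.mem_univ, true_and] at hI hImax
  refine ⟨I.image x, Finset.card_image_le.trans ?_, fun i => ?_⟩
  · have h1 : (I.card : ℝ) * (c * β ^ M) ≤ 1 := by
      calc (I.card : ℝ) * (c * β ^ M) = ∑ i ∈ I, c * β ^ M := by simp
        _ ≤ ∑ i ∈ I, ∑ g ∈ A i, ∏ j, w (g j) := Finset.sum_le_sum fun i _ => hA i
        _ = ∑ g ∈ I.biUnion A, ∏ j, w (g j) := (Finset.sum_biUnion hI).symm
        _ ≤ ∑ g : Fin M → X, ∏ j, w (g j) :=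
          Finset.sum_le_univ_sum_of_nonneg hW0
        _ = 1 := sum_prod_eq_one hw1
    have h2 : (I.card : ℝ) ≤ 1 / (c * β ^ M) := by rwa [le_div_iff₀ hcβ]
    exact_mod_cast h2.trans (Nat.le_ceil _)
  · obtain ⟨g, hg⟩ : (A i).Nonempty := by
      rw [Finset.nonempty_iff_ne_empty]
      intro h
      have := hA i
      rw [h, Finset.sum_empty] at this
      linarith
    by_cases hiI : i ∈ I
    · exact ⟨x i, Finset.mem_image_of_mem x hiI, hAK i i g hg hg⟩
    · obtain ⟨s, hs, hdis⟩ : ∃ s ∈ I, ¬ Disjoint (A i) (A s) := by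
        by_contra! hall
        have : ((insert i I : Finset (Fin n)) : Set (Fin n)).PairwiseDisjoint A := by
          rw [Finset.coe_insert]
          exact hI.insert fun s hs _ => hall s hs
        have := hImax _ this
        rw [Finset.card_insert_of_notMem hiI] at this
        lia
      obtain ⟨g, hgi, hgs⟩ := Finset.not_disjoint_iff.1 hdis
      exact ⟨x s, Finset.mem_image_of_mem x hs, hAK i s g hgi hgs⟩

/-- The Alon-Kleitman `(p, q)` theorem, with the hypothesis phrased for sequences of indices. -/
theorem pq_theorem (P : ℕ) :
    ∃ H : ℕ, ∀ {n : ℕ} (K : Fin n → Set E), (∀ i, Convex ℝ (K i)) →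
      (∀ f : Fin P → Fin n, ∃ S : Finset (Fin P), S.card = Module.finrank ℝ E + 1 ∧
        (⋂ j ∈ S, K (f j)).Nonempty) →
      ∃ T : Finset E, T.card ≤ H ∧ ∀ i, ∃ x ∈ T, x ∈ K i := by
  obtain ⟨β, hβ, hfh⟩ := fractional_helly_weighted (E := E) P
  obtain ⟨N, hN⟩ := exists_weak_net (E := E) hβ
  refine ⟨N, fun {n} K hK hint => ?_⟩
  obtain ⟨X, _, w, q, hw0, hw1, hmass⟩ :=
    exists_weights_of_forall_weights K fun w hw0 hw1 => hfh w hw0 hw1 K hK hint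
  exact hN w hw0 hw1 q K hK hmass

end FractionalHelly

section Ramsey

/-- Ramsey's theorem for `k`-uniform hypergraphs and two colours. -/
theorem exists_homogeneous_subset : ∀ k a b : ℕ, ∃ N : ℕ, ∀ {α : Type*} [DecidableEq α]
    (X : Finset α), N ≤ X.card → ∀ χ : Finset α → Prop,
      (∃ S ⊆ X, S.card = a ∧ ∀ T ⊆ S, T.card = k → χ T) ∨
        ∃ S ⊆ X, S.card = b ∧ ∀ T ⊆ S, T.card = k → ¬χ T := by
  intro k
  induction k with
  | zero =>
    refine fun a b => ⟨max a b, fun {α} _ X hX χ => ?_⟩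
    by_cases h : χ ∅
    · obtain ⟨S, hS, hc⟩ := Finset.exists_subset_card_eq ((le_max_left a b).trans hX)
      exact Or.inl ⟨S, hS, hc, fun T _ hT => by rwa [Finset.card_eq_zero.1 hT]⟩
    · obtain ⟨S, hS, hc⟩ := Finset.exists_subset_card_eq ((le_max_right a b).trans hX)
      exact Or.inr ⟨S, hS, hc, fun T _ hT => by rwa [Finset.card_eq_zero.1 hT]⟩
  | succ k ih =>
    intro a
    induction a with
    | zero => exact fun b => ⟨0, fun {α} _ X _ χ => Or.inl ⟨∅, by simp, rfl, by
        intro T hT hc; simp_all⟩⟩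
    | succ a iha =>
      intro b
      induction b with
      | zero => exact ⟨0, fun {α} _ X _ χ => Or.inr ⟨∅, by simp, rfl, by
          intro T hT hc; simp_all⟩⟩
      | succ b ihb =>
        obtain ⟨N₁, h₁⟩ := iha (b + 1)
        obtain ⟨N₂, h₂⟩ := ihb
        obtain ⟨N, hN⟩ := ih N₁ N₂
        refine ⟨N + 1, fun {α} _ X hX χ => ?_⟩
        obtain ⟨v, hv⟩ : X.Nonempty := Finset.card_pos.1 (by omega)
        have key : ∀ (S : Finset α) (χ : Finset α → Prop), v ∉ S →
            (∀ T ⊆ S, T.card = k → χ (insert v T)) → (∀ T ⊆ S, T.card = k + 1 → χ T) →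
            ∀ T ⊆ insert v S, T.card = k + 1 → χ T := by
          intro S χ hvS h h' T hT hc
          by_cases hvT : v ∈ T
          · rw [← Finset.insert_erase hvT]
            refine h _ ?_ (by rw [Finset.card_erase_of_mem hvT, hc]; rfl)
            rwa [← Finset.subset_insert_iff]
          · exact h' T ((Finset.subset_insert_iff_of_notMem hvT).1 hT) hc
        have hXe : N ≤ (X.erase v).card := by rw [Finset.card_erase_of_mem hv]; omega
        rcases hN (X.erase v) hXe fun T => χ (insert v T) with ⟨Y, hY, hc, hχ⟩ | ⟨Y, hY, hc, hχ⟩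
        · have hvY : v ∉ Y := fun h => by simpa using hY h
          have hYX : Y ⊆ X := hY.trans (Finset.erase_subset _ _)
          rcases h₁ Y hc.ge χ with ⟨S, hS, hSc, hSχ⟩ | ⟨S, hS, hSc, hSχ⟩
          · have hvS : v ∉ S := fun h => hvY (hS h)
            exact Or.inl ⟨insert v S, Finset.insert_subset hv (hS.trans hYX),
              by rw [Finset.card_insert_of_notMem hvS, hSc],
              key S χ hvS (fun T hT => hχ T (hT.trans hS)) hSχ⟩
          · exact Or.inr ⟨S, hS.trans hYX, hSc, hSχ⟩
        · have hvY : v ∉ Y := fun h => by simpa using hY h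
          have hYX : Y ⊆ X := hY.trans (Finset.erase_subset _ _)
          rcases h₂ Y hc.ge χ with ⟨S, hS, hSc, hSχ⟩ | ⟨S, hS, hSc, hSχ⟩
          · exact Or.inl ⟨S, hS.trans hYX, hSc, hSχ⟩
          · have hvS : v ∉ S := fun h => hvY (hS h)
            exact Or.inr ⟨insert v S, Finset.insert_subset hv (hS.trans hYX),
              by rw [Finset.card_insert_of_notMem hvS, hSc],
              key S (fun T => ¬χ T) hvS (fun T hT => hχ T (hT.trans hS)) hSχ⟩

/-- A property of `k`-sets which holds for singletons and for some `k`-subset of every `p`-set holds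
for the image of some `k` terms among any `p * k` terms of a sequence. -/
theorem exists_subset_card_eq_image {α β : Type*} [DecidableEq α] [DecidableEq β] (f : α → β)
    {R : Finset β → Prop} {p k : ℕ} (hk : 0 < k) (hR₁ : ∀ b, R {b})
    (hR : ∀ S : Finset β, S.card = p → ∃ T ⊆ S, T.card = k ∧ R T) {S : Finset α}
    (hS : S.card = p * k) : ∃ T ⊆ S, T.card = k ∧ R (T.image f) := by
  by_cases hfib : ∃ b ∈ S.image f, k ≤ (S.filter (f · = b)).card
  · obtain ⟨b, -, hb⟩ := hfib
    obtain ⟨T, hTS, hT⟩ := Finset.exists_subset_card_eq hb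
    refine ⟨T, hTS.trans (Finset.filter_subset _ _), hT, ?_⟩
    have himage : T.image f = {b} := by
      refine (Finset.image_congr fun a ha => (Finset.mem_filter.1 (hTS ha)).2).trans
        (Finset.image_const (Finset.card_pos.1 (hT ▸ hk)) b)
    rw [himage]
    exact hR₁ b
  · push Not at hfib
    have hcard := Finset.card_le_mul_card_image (f := f) S (k - 1) fun b hb =>
      Nat.le_sub_one_of_lt (hfib b hb)
    have hpimage : p ≤ (S.image f).card := by
      by_contra! hlt
      have h1 : (k - 1) * (S.image f).card ≤ k * (S.image f).card :=
        Nat.mul_le_mul_right _ (Nat.sub_le _ _)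
      have h2 : k * (S.image f).card < k * p := Nat.mul_lt_mul_of_pos_left hlt hk
      rw [hS, mul_comm p k] at hcard
      omega
    obtain ⟨S', hS', hS'p⟩ := Finset.exists_subset_card_eq hpimage
    obtain ⟨T', hT', hT'k, hRT⟩ := hR S' hS'p
    have hsec : ∀ b ∈ T', ∃ a ∈ S, f a = b := fun b hb =>
      Finset.mem_image.1 (hS' (hT' hb))
    have : ∃ T ⊆ S, T.card = k ∧ T.image f = T' := by
      obtain ⟨b₀, hb₀⟩ := Finset.card_pos.1 (hT'k ▸ hk)
      obtain ⟨a₀, -⟩ := hsec b₀ hb₀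
      have : Nonempty α := ⟨a₀⟩
      choose! g hgS hfg using hsec
      have hinj : Set.InjOn g T' := fun a ha b hb hab => by
        rw [← hfg a ha, ← hfg b hb, hab]
      refine ⟨T'.image g, Finset.image_subset_iff.2 hgS, ?_, ?_⟩
      · rw [Finset.card_image_of_injOn hinj, hT'k]
      · rw [Finset.image_image]
        exact (Finset.image_congr fun b hb => hfg b hb).trans Finset.image_id
    obtain ⟨T, hT, hTk, hTT'⟩ := this
    exact ⟨T, hT, hTk, hTT' ▸ hRT⟩

end Ramsey

section QuantitativeHelly

theorem exists_asymmetry_le_finrank {E : Type*} [NormedAddCommGroup E] [InnerProductSpace ℝ E]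
    [FiniteDimensional ℝ E] (hE : 0 < Module.finrank ℝ E) {K : Set E} (hK : Convex ℝ K)
    (hKc : IsCompact K) (hKi : (interior K).Nonempty) :
    ∃ x₀ ∈ interior K, ∀ y ∈ K, x₀ + (1 / (Module.finrank ℝ E : ℝ)) • (x₀ - y) ∈ K := by
  classical
  set d := Module.finrank ℝ E
  have hd : (0 : ℝ) < d := by exact_mod_cast hE
  let F : K → Set E := fun y => (fun x => (d / (d + 1) : ℝ) • x + (1 / (d + 1) : ℝ) • (y : E)) '' K
  have hcomb : (d / (d + 1) : ℝ) + 1 / (d + 1) = 1 := by field_simp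
  have hF : ∀ (y : K) (x : E), x + (1 / (d : ℝ)) • (x - y) ∈ K → x ∈ F y := by
    intro y x hx
    refine ⟨_, hx, ?_⟩
    simp only
    match_scalars <;> field_simp <;> ring
  have hF' : ∀ (y : K) (x : E), x ∈ F y → x + (1 / (d : ℝ)) • (x - y) ∈ K := by
    rintro y _ ⟨k, hk, rfl⟩
    convert hk using 1
    match_scalars <;> field_simp <;> ring
  obtain ⟨x₀, hx₀⟩ : (⋂ y, F y).Nonempty := by
    refine Convex.helly_theorem_compact' (𝕜 := ℝ) (fun y => ?_) (fun y => ?_) fun I hI => ?_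
    · have := (hK.smul (d / (d + 1) : ℝ)).translate ((1 / (d + 1) : ℝ) • (y : E))
      rw [← Set.image_smul, Set.image_image] at this
      simpa only [F, add_comm] using this
    · exact hKc.image (by fun_prop)
    · obtain ⟨w, hw⟩ := hKi
      have hw := interior_subset hw
      let m : ℕ := d + 1 - I.card
      have hm : (m : ℝ) + I.card = d + 1 := by
        have : m + I.card = d + 1 := Nat.sub_add_cancel hI
        exact_mod_cast this
      refine ⟨(1 / (d + 1) : ℝ) • ((∑ y ∈ I, (y : E)) + (m : ℝ) • w), Set.mem_iInter₂.2 fun y hy => ?_⟩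
      apply hF
      have hcard : ((I.erase y).card : ℝ) = I.card - 1 := by
        rw [Finset.card_erase_of_mem hy, Nat.cast_sub (Finset.card_pos.2 ⟨y, hy⟩)]; simp
      have hmem := hK.sum_mem (t := Finset.insertNone (I.erase y))
        (w := fun o : Option K => o.elim ((m : ℝ) / d) fun _ => 1 / d)
        (z := fun o : Option K => o.elim w fun y => (y : E))
        (by rintro (_ | i) _ <;> simp <;> positivity)
        (by
          simp only [Finset.sum_insertNone, Option.elim, Finset.sum_const, nsmul_eq_mul, hcard]
          field_simp
          linarith)
        (by rintro (_ | i) _ <;> simp [hw])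
      convert hmem using 1
      simp only [Finset.sum_insertNone, Option.elim]
      rw [← Finset.add_sum_erase I _ hy, ← Finset.smul_sum]
      match_scalars <;> field_simp <;> ring
  rw [Set.mem_iInter] at hx₀
  have hx : ∀ y ∈ K, x₀ + (1 / (d : ℝ)) • (x₀ - y) ∈ K := fun y hy => hF' ⟨y, hy⟩ x₀ (hx₀ ⟨y, hy⟩)
  refine ⟨x₀, ?_, hx⟩
  obtain ⟨w, hw⟩ := hKi
  refine hK.openSegment_interior_self_subset_interior hw (hx w (interior_subset hw)) ?_
  refine ⟨1 / (d + 1), d / (d + 1), by positivity, by positivity, by rw [add_comm]; exact hcomb, ?_⟩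
  match_scalars <;> field_simp <;> ring

theorem exists_maximal_det {d : ℕ} {Y : Set (EuclideanSpace ℝ (Fin d))} (hY : IsCompact Y) {r : ℝ}
    (hr : 0 < r) (hrY : Metric.closedBall 0 r ⊆ Y) :
    ∃ v : Fin d → EuclideanSpace ℝ (Fin d), (∀ i, v i ∈ Y) ∧
      (Matrix.of fun i j => v i j).det ≠ 0 ∧
      ∀ y ∈ Y, ∃ a : Fin d → ℝ, (∀ i, |a i| ≤ 1) ∧ y = ∑ i, a i • v i := by
  let M : (Fin d → EuclideanSpace ℝ (Fin d)) → Matrix (Fin d) (Fin d) ℝ :=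
    fun v => Matrix.of fun i j => v i j
  let e : Fin d → EuclideanSpace ℝ (Fin d) := fun i => r • EuclideanSpace.single i 1
  have he : ∀ i, e i ∈ Y := fun i => hrY (by simp [e, norm_smul, abs_of_pos hr])
  obtain ⟨v, hv, hmax⟩ := (isCompact_univ_pi fun _ : Fin d => hY).exists_isMaxOn
    (f := fun v => |(M v).det|) ⟨e, fun i _ => he i⟩ (by
      refine Continuous.continuousOn ?_
      refine continuous_abs.comp (Continuous.matrix_det ?_)
      refine continuous_matrix fun i j => ?_
      simp only [M, Matrix.of_apply]
      fun_prop)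
  have hv : ∀ i, v i ∈ Y := fun i => hv i trivial
  have hMe : M e = r • (1 : Matrix (Fin d) (Fin d) ℝ) := by
    ext i j
    simp [M, e, Matrix.one_apply, eq_comm]
  have hpos : 0 < |(M v).det| := by
    refine lt_of_lt_of_le ?_ (hmax (show e ∈ _ from fun i _ => he i))
    simp only [hMe, Matrix.det_smul, Matrix.det_one]
    positivity
  have hdet : (M v).det ≠ 0 := abs_pos.1 hpos
  refine ⟨v, hv, hdet, fun y hy => ?_⟩
  refine ⟨fun i => ((M v).det)⁻¹ * (M v).transpose.cramer y i, fun i => ?_, ?_⟩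
  · beta_reduce
    rw [Matrix.cramer_transpose_apply]
    have hup : (M v).updateRow i y = M (Function.update v i y) := by
      ext k l
      by_cases h : k = i
      · subst h; simp [M]
      · simp [M, h]
    have hle : |(M (Function.update v i y)).det| ≤ |(M v).det| := by
      refine hmax (show _ ∈ _ from fun k _ => ?_)
      by_cases h : k = i
      · subst h; simpa using hy
      · simpa [h] using hv k
    rw [hup, abs_mul, abs_inv, inv_mul_le_iff₀ hpos]
    simpa using hle
  · have hc := Matrix.mulVec_cramer (M v).transpose y
    ext j
    have hj := congrFun hc j
    simp only [Matrix.mulVec, dotProduct, Matrix.transpose_apply, Matrix.det_transpose,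
      Pi.smul_apply, smul_eq_mul] at hj
    have : y j = ((M v).det)⁻¹ * ∑ x, M v x j * ((M v).transpose.cramer y) x := by
      rw [hj, inv_mul_cancel_left₀ hdet]
    rw [this, Finset.mul_sum]
    simp only [WithLp.ofLp_sum, WithLp.ofLp_smul, Finset.sum_apply, Pi.smul_apply, smul_eq_mul]
    exact Finset.sum_congr rfl fun x _ => by simp only [M, Matrix.of_apply]; ring

theorem isCompact_iInter_inner_le_one {E : Type*} [NormedAddCommGroup E] [InnerProductSpace ℝ E]
    [FiniteDimensional ℝ E] {K : Set E} (hK : 0 ∈ interior K) :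
    IsCompact (⋂ x ∈ K, {y : E | inner ℝ y x ≤ 1}) := by
  obtain ⟨ρ, hρ, hball⟩ := Metric.nhds_basis_closedBall.mem_iff.1 (mem_interior_iff_mem_nhds.1 hK)
  refine Metric.isCompact_of_isClosed_isBounded
    (isClosed_biInter fun x _ => isClosed_le (by fun_prop) continuous_const)
    (Metric.isBounded_closedBall (x := (0 : E)) (r := 1 / ρ) |>.subset fun y hy => ?_)
  rw [mem_closedBall_zero_iff]
  rcases eq_or_ne y 0 with rfl | hy0
  · simp [hρ.le]
  have hyn : 0 < ‖y‖ := norm_pos_iff.2 hy0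
  have h := Set.mem_iInter₂.1 hy ((ρ / ‖y‖) • y) (hball (by
    rw [mem_closedBall_zero_iff, norm_smul, norm_div, norm_norm, div_mul_cancel₀ _ hyn.ne']
    simp [abs_of_pos hρ]))
  simp only [Set.mem_ofPred_eq, inner_smul_right, real_inner_self_eq_norm_sq] at h
  rw [le_div_iff₀ hρ]
  calc ‖y‖ * ρ = ρ / ‖y‖ * ‖y‖ ^ 2 := by field_simp
    _ ≤ 1 := h

theorem mem_of_forall_inner_le_one {E : Type*} [NormedAddCommGroup E] [InnerProductSpace ℝ E]
    [FiniteDimensional ℝ E] {K : Set E} (hK : Convex ℝ K) (hKc : IsClosed K) (h0 : 0 ∈ K) {x : E}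
    (hx : ∀ y : E, (∀ z ∈ K, inner ℝ y z ≤ 1) → inner ℝ y x ≤ 1) : x ∈ K := by
  by_contra hxK
  obtain ⟨f, u, hf, hu⟩ := geometric_hahn_banach_closed_point hK hKc hxK
  have hu0 : 0 < u := by simpa using hf 0 h0
  let y := (InnerProductSpace.toDual ℝ E).symm f
  have hy : ∀ z, inner ℝ (u⁻¹ • y) z = u⁻¹ * f z := fun z => by
    rw [real_inner_smul_left, InnerProductSpace.toDual_symm_apply]
  have h := hx (u⁻¹ • y) fun z hz => by
    rw [hy, inv_mul_le_iff₀ hu0, mul_one]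
    exact (hf z hz).le
  rw [hy, inv_mul_le_iff₀ hu0, mul_one] at h
  exact absurd hu h.not_gt

theorem det_toEuclideanLin {d : ℕ} (A : Matrix (Fin d) (Fin d) ℝ) :
    LinearMap.det A.toEuclideanLin = A.det := by
  rw [Matrix.toEuclideanLin, Matrix.toLpLin_eq_toLin, LinearMap.det_toLin]

theorem abs_det_le_of_image_subset_Icc {d : ℕ} {A : Matrix (Fin d) (Fin d) ℝ} {a b : ℝ}
    (hab : a ≤ b) {M : Set (EuclideanSpace ℝ (Fin d))} (hM : 1 ≤ volume M)
    (h : ∀ x ∈ M, ∀ i, A.toEuclideanLin x i ∈ Set.Icc a b) : |A.det| ≤ (b - a) ^ d := by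
  have himg : A.toEuclideanLin '' M ⊆ WithLp.ofLp ⁻¹' Set.Icc (fun _ : Fin d => a) fun _ => b := by
    rintro _ ⟨x, hx, rfl⟩
    exact ⟨fun i => (h x hx i).1, fun i => (h x hx i).2⟩
  have hle := measure_mono (μ := volume) himg
  rw [Measure.addHaar_image_linearMap, det_toEuclideanLin,
    (PiLp.volume_preserving_ofLp (Fin d)).measure_preimage
      measurableSet_Icc.nullMeasurableSet, Real.volume_Icc_pi] at hle
  simp only [Finset.prod_const, Finset.card_univ, Fintype.card_fin] at hle
  rw [← ENNReal.ofReal_pow (sub_nonneg.2 hab)] at hle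
  refine (ENNReal.ofReal_le_ofReal_iff (pow_nonneg (sub_nonneg.2 hab) d)).1 (le_trans ?_ hle)
  exact le_mul_of_one_le_right zero_le hM

theorem exists_finset_card_le_mem_convexHull {E : Type*} [NormedAddCommGroup E]
    [InnerProductSpace ℝ E] [FiniteDimensional ℝ E] {s : Set E} {x : E} (hx : x ∈ convexHull ℝ s) :
    ∃ t : Finset E, ↑t ⊆ s ∧ t.card ≤ Module.finrank ℝ E + 1 ∧ x ∈ convexHull ℝ (t : Set E) := by
  rw [convexHull_eq_union] at hx
  simp only [Set.mem_iUnion, exists_prop] at hx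
  obtain ⟨t, hts, hind, hxt⟩ := hx
  refine ⟨t, hts, ?_, hxt⟩
  have := hind.card_le_finrank_succ
  rw [Fintype.card_coe] at this
  exact this.trans (Nat.succ_le_succ (Submodule.finrank_le _))

theorem exists_ball_image_subset_of_asymmetry {d : ℕ} (hd : 1 ≤ d) {ι : Type*} [Fintype ι]
    [Nonempty ι] {K : ι → Set (EuclideanSpace ℝ (Fin d))} (hK : ∀ i, Convex ℝ (K i))
    (hKc : ∀ i, IsCompact (K i)) (h0 : ∀ i, 0 ∈ interior (K i))
    (hasym : ∀ x, (∀ i, x ∈ K i) → ∀ i, -((1 / (d : ℝ)) • x) ∈ K i)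
    (hvol : ∀ T : Finset ι, T.card ≤ 2 * d + 1 →
      ∃ M : Set (EuclideanSpace ℝ (Fin d)), 1 ≤ volume M ∧ ∀ i ∈ T, M ⊆ K i) :
    ∃ ψ : EuclideanSpace ℝ (Fin d) ≃ₗ[ℝ] EuclideanSpace ℝ (Fin d),
      (∀ i, ψ '' Metric.closedBall 0 1 ⊆ K i) ∧
      ((2 * (d : ℝ) ^ 3)⁻¹) ^ d ≤
        |LinearMap.det (ψ : EuclideanSpace ℝ (Fin d) →ₗ[ℝ] EuclideanSpace ℝ (Fin d))| := by
  classical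
  have hd' : (1 : ℝ) ≤ d := by exact_mod_cast hd
  have hd0 : (0 : ℝ) < d := by linarith
  let P : ι → Set (EuclideanSpace ℝ (Fin d)) := fun i => ⋂ x ∈ K i, {y | inner ℝ y x ≤ 1}
  let Y := ⋃ i, P i
  have hYc : IsCompact Y := isCompact_iUnion fun i => isCompact_iInter_inner_le_one (h0 i)
  have hmemY : ∀ {y}, y ∈ Y ↔ ∃ i, ∀ x ∈ K i, inner ℝ y x ≤ 1 := by
    intro y; simp [Y, P]
  obtain ⟨r, hr, hrY⟩ : ∃ r : ℝ, 0 < r ∧ Metric.closedBall 0 r ⊆ Y := by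
    let i := Classical.arbitrary ι
    obtain ⟨R, hR, hKR⟩ := (hKc i).isBounded.exists_pos_norm_le
    refine ⟨1 / R, by positivity, fun y hy => hmemY.2 ⟨i, fun x hx => ?_⟩⟩
    rw [mem_closedBall_zero_iff] at hy
    calc inner ℝ y x ≤ ‖y‖ * ‖x‖ := real_inner_le_norm _ _
      _ ≤ 1 / R * R := by gcongr; exact hKR x hx
      _ = 1 := by field_simp
  have hmemK : ∀ x, (∀ y ∈ Y, inner ℝ y x ≤ 1) → ∀ i, x ∈ K i := fun x hx i =>
    mem_of_forall_inner_le_one (hK i) (hKc i).isClosed (interior_subset (h0 i)) fun y hy =>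
      hx y (hmemY.2 ⟨i, hy⟩)
  obtain ⟨v, hvY, hdet, hspan⟩ := exists_maximal_det hYc hr hrY
  set A : Matrix (Fin d) (Fin d) ℝ := Matrix.of fun i j => v i j
  have hA : ∀ x i, A.toEuclideanLin x i = inner ℝ (v i) x := fun x i => by
    simp [A, Matrix.toLpLin_apply, Matrix.mulVec, dotProduct, PiLp.inner_apply, mul_comm]
  have hmemconv : -((1 / (d : ℝ) ^ 2) • ∑ i, v i) ∈ convexHull ℝ Y := by
    refine mem_of_forall_inner_le_one (convex_convexHull ℝ Y)
      (isCompact_convexHull_of_isCompact hYc).isClosed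
      (subset_convexHull ℝ Y (hrY (by simp [hr.le]))) fun x hx => ?_
    have hxK := hmemK x fun y hy => by
      rw [real_inner_comm]; exact hx y (subset_convexHull ℝ Y hy)
    have hneg := hasym x hxK
    have hvi : ∀ i, -inner ℝ x (v i) ≤ d := fun i => by
      obtain ⟨j, hj⟩ := hmemY.1 (hvY i)
      have := hj _ (hneg j)
      rw [inner_neg_right, real_inner_smul_right, real_inner_comm] at this
      rwa [one_div, inv_mul_eq_div, ← neg_div, div_le_one hd0] at this
    rw [inner_neg_right, real_inner_smul_right, inner_sum]
    calc -(1 / (d : ℝ) ^ 2 * ∑ i, inner ℝ x (v i)) = 1 / (d : ℝ) ^ 2 * ∑ i, -inner ℝ x (v i) := by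
          rw [Finset.sum_neg_distrib]; ring
      _ ≤ 1 / (d : ℝ) ^ 2 * ∑ _i : Fin d, (d : ℝ) := by gcongr; exact hvi _
      _ = 1 := by simp; field_simp
  obtain ⟨t, htY, htc, hmt⟩ := exists_finset_card_le_mem_convexHull hmemconv
  choose j hj using fun y : Y => hmemY.1 y.2
  let T : Finset ι := Finset.univ.image (fun i => j ⟨v i, hvY i⟩) ∪
    Finset.univ.image fun y : t => j ⟨y, htY y.2⟩
  have hTc : T.card ≤ 2 * d + 1 := by
    have h1 : (Finset.univ.image fun i => j ⟨v i, hvY i⟩).card ≤ d :=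
      Finset.card_image_le.trans (by simp)
    have h2 : (Finset.univ.image fun y : t => j ⟨y, htY y.2⟩).card ≤ d + 1 :=
      Finset.card_image_le.trans (by simpa using htc)
    have := Finset.card_union_le (Finset.univ.image fun i => j ⟨v i, hvY i⟩)
      (Finset.univ.image fun y : t => j ⟨y, htY y.2⟩)
    simp only [T]
    omega
  obtain ⟨M, hM1, hMK⟩ := hvol T hTc
  have hup : ∀ x ∈ M, ∀ i, inner ℝ (v i) x ≤ 1 := fun x hx i =>
    hj ⟨v i, hvY i⟩ x (hMK _ (Finset.mem_union_left _
      (Finset.mem_image_of_mem _ (Finset.mem_univ i))) hx)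
  have hlow : ∀ x ∈ M, -∑ i, inner ℝ (v i) x ≤ (d : ℝ) ^ 2 := fun x hx => by
    have hsub : convexHull ℝ (t : Set (EuclideanSpace ℝ (Fin d))) ⊆ {y | inner ℝ y x ≤ 1} := by
      refine convexHull_min (fun y hy => ?_) ?_
      · exact hj ⟨y, htY hy⟩ x (hMK _ (Finset.mem_union_right _
          (Finset.mem_image_of_mem (fun y : t => j ⟨y, htY y.2⟩)
            (Finset.mem_univ (⟨y, hy⟩ : t)))) hx)
      · exact convex_halfSpace_le ⟨fun _ _ => inner_add_left _ _ _,
          fun _ _ => real_inner_smul_left _ _ _⟩ 1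
    have := hsub hmt
    simp only [Set.mem_ofPred_eq, inner_neg_left, real_inner_smul_left, sum_inner] at this
    have h2 : -(∑ i, inner ℝ (v i) x) / (d : ℝ) ^ 2 ≤ 1 := by
      rw [← one_div_mul_eq_div]; linarith
    rwa [div_le_one (by positivity)] at h2
  have hAdet : |A.det| ≤ (2 * (d : ℝ) ^ 2) ^ d := by
    refine (abs_det_le_of_image_subset_Icc (a := -((d : ℝ) ^ 2) - (d - 1)) (b := 1) (by nlinarith)
      hM1 fun x hx i => ?_).trans (pow_le_pow_left₀ (by nlinarith) (by nlinarith) d)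
    rw [hA]
    refine ⟨?_, hup x hx i⟩
    have h1 := hlow x hx
    rw [← Finset.add_sum_erase _ _ (Finset.mem_univ i)] at h1
    have h2 : ∑ k ∈ Finset.univ.erase i, inner ℝ (v k) x ≤ (d : ℝ) - 1 := by
      refine (Finset.sum_le_card_nsmul _ _ 1 fun k _ => hup x hx k).trans ?_
      simp [Finset.card_erase_of_mem, Nat.cast_sub hd]
    linarith
  have hunit : IsUnit (LinearMap.det ((d : ℝ) • A.toEuclideanLin)) := by
    rw [LinearMap.det_smul, det_toEuclideanLin]
    exact (mul_ne_zero (pow_ne_zero _ hd0.ne') hdet).isUnit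
  let φ := LinearMap.equivOfIsUnitDet hunit
  have hφ : ∀ x, φ x = (d : ℝ) • A.toEuclideanLin x := LinearMap.equivOfIsUnitDet_apply hunit
  refine ⟨φ.symm, ?_, ?_⟩
  · rintro i _ ⟨u, hu, rfl⟩
    rw [mem_closedBall_zero_iff] at hu
    refine hmemK _ (fun y hy => ?_) i
    obtain ⟨a, ha, rfl⟩ := hspan y hy
    have hin : ∀ i, inner ℝ (v i) (φ.symm u) = u i / d := fun i => by
      have : u i = d * inner ℝ (v i) (φ.symm u) := by
        conv_lhs => rw [← φ.apply_symm_apply u, hφ]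
        rw [← hA]; simp
      rw [this]; field_simp
    simp only [sum_inner, real_inner_smul_left, hin]
    calc ∑ i, a i * (u i / d) ≤ ∑ _i : Fin d, 1 / (d : ℝ) := by
          refine Finset.sum_le_sum fun i _ => ?_
          rw [← mul_div_assoc]
          gcongr
          refine (le_abs_self _).trans ?_
          rw [abs_mul]
          exact mul_le_one₀ (ha i) (abs_nonneg _) (((PiLp.norm_apply_le u i)).trans hu)
      _ = 1 := by simp; field_simp
  · have h1 : LinearMap.det (φ.symm : EuclideanSpace ℝ (Fin d) →ₗ[ℝ] EuclideanSpace ℝ (Fin d)) =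
        ((d : ℝ) ^ d * A.det)⁻¹ := by
      rw [eq_comm, inv_eq_of_mul_eq_one_left]
      have := LinearEquiv.det_symm_mul_det φ
      have h2 : (φ : EuclideanSpace ℝ (Fin d) →ₗ[ℝ] EuclideanSpace ℝ (Fin d)) =
        (d : ℝ) • A.toEuclideanLin := LinearMap.coe_equivOfIsUnitDet hunit
      rw [h2, LinearMap.det_smul, det_toEuclideanLin] at this
      simpa using this
    rw [h1, abs_inv, abs_mul, abs_pow, abs_of_pos hd0, inv_pow]
    refine inv_anti₀ (by positivity) ?_
    calc (d : ℝ) ^ d * |A.det| ≤ (d : ℝ) ^ d * (2 * (d : ℝ) ^ 2) ^ d := by gcongr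
      _ = (2 * (d : ℝ) ^ 3) ^ d := by rw [← mul_pow]; ring

theorem interior_nonempty_of_volume_ne_zero {d : ℕ} {M : Set (EuclideanSpace ℝ (Fin d))}
    (hM : Convex ℝ M) (h : volume M ≠ 0) : (interior M).Nonempty := by
  by_contra hempty
  rw [Set.not_nonempty_iff_eq_empty] at hempty
  refine h (measure_mono_null (subset_closure.trans ?_) (hM.addHaar_frontier volume))
  rw [frontier, hempty, Set.sdiff_empty]

/-- A quantitative Helly theorem: if any `2 * d + 1` sets share a convex body of volume at least one,
then all of them share a large affine image of the unit ball. -/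
theorem quantitative_helly {d : ℕ} (hd : 1 ≤ d) {ι : Type*} [Fintype ι] [Nonempty ι]
    {C : ι → Set (EuclideanSpace ℝ (Fin d))} (hC : ∀ i, Convex ℝ (C i))
    (h : ∀ T : Finset ι, T.card ≤ 2 * d + 1 → ∃ M : Set (EuclideanSpace ℝ (Fin d)),
      Convex ℝ M ∧ IsCompact M ∧ 1 ≤ volume M ∧ ∀ i ∈ T, M ⊆ C i) :
    ∃ (x₀ : EuclideanSpace ℝ (Fin d)) (ψ : EuclideanSpace ℝ (Fin d) ≃ₗ[ℝ] EuclideanSpace ℝ (Fin d)),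
      (∀ i, ∀ u ∈ Metric.closedBall 0 1, x₀ + ψ u ∈ C i) ∧
      ((2 * (d : ℝ) ^ 3)⁻¹) ^ d ≤
        |LinearMap.det (ψ : EuclideanSpace ℝ (Fin d) →ₗ[ℝ] EuclideanSpace ℝ (Fin d))| := by
  classical
  choose M hMconv hMc hM1 hMC using fun T : {T : Finset ι // T.card ≤ 2 * d + 1} => h T.1 T.2
  let K : ι → Set (EuclideanSpace ℝ (Fin d)) := fun i =>
    convexHull ℝ (⋃ T : {T : {T : Finset ι // T.card ≤ 2 * d + 1} // i ∈ T.1}, M T)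
  have hMK : ∀ T : {T : Finset ι // T.card ≤ 2 * d + 1}, ∀ i ∈ T.1, M T ⊆ K i := fun T i hi =>
    (Set.subset_iUnion (fun T : {T : {T : Finset ι // T.card ≤ 2 * d + 1} // i ∈ T.1} => M T)
      ⟨T, hi⟩).trans (subset_convexHull ℝ _)
  have hKC : ∀ i, K i ⊆ C i := fun i =>
    convexHull_min (Set.iUnion_subset fun T => hMC T.1 i T.2) (hC i)
  have hKc : ∀ i, IsCompact (K i) := fun i =>
    isCompact_convexHull_of_isCompact (isCompact_iUnion fun T => hMc T.1)
  have hKconv : ∀ i, Convex ℝ (K i) := fun i => convex_convexHull ℝ _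
  have hint : (interior (⋂ i, K i)).Nonempty := by
    rw [interior_iInter_of_finite]
    have := Convex.helly_theorem' (𝕜 := ℝ) (F := fun i => interior (K i)) (s := Finset.univ)
      (fun i _ => (hKconv i).interior) fun I _ hI => by
        rw [finrank_euclideanSpace_fin] at hI
        have hI' : I.card ≤ 2 * d + 1 := by omega
        exact (interior_nonempty_of_volume_ne_zero (hMconv ⟨I, hI'⟩)
          (zero_lt_one.trans_le (hM1 ⟨I, hI'⟩)).ne').mono
          (Set.subset_iInter₂ fun i hi => interior_mono (hMK ⟨I, hI'⟩ i hi))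
    simpa using this
  obtain ⟨x₀, hx₀, hasym⟩ := exists_asymmetry_le_finrank
    (by rw [finrank_euclideanSpace_fin]; omega) (convex_iInter hKconv)
    ((hKc (Classical.arbitrary ι)).of_isClosed_subset (isClosed_iInter fun i => (hKc i).isClosed)
      (Set.iInter_subset _ _)) hint
  rw [finrank_euclideanSpace_fin] at hasym
  have hcont : Continuous fun u : EuclideanSpace ℝ (Fin d) => x₀ + u := by fun_prop
  obtain ⟨ψ, hψ, hdet⟩ := exists_ball_image_subset_of_asymmetry hd
    (K := fun i => (fun u => x₀ + u) ⁻¹' K i) (fun i => (hKconv i).translate_preimage_right x₀)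
    (fun i => (Homeomorph.addLeft x₀).isClosedEmbedding.isCompact_preimage (hKc i))
    (fun i => preimage_interior_subset_interior_preimage hcont (by
      simpa using interior_mono (Set.iInter_subset _ i) hx₀))
    (fun x hx i => by
      have := hasym (x₀ + x) (Set.mem_iInter.2 hx)
      have := Set.mem_iInter.1 this i
      simpa using this)
    (fun T hT => ⟨(fun u => x₀ + u) ⁻¹' M ⟨T, hT⟩, by
      rw [measure_preimage_add]; exact hM1 _, fun i hi => Set.preimage_mono (hMK ⟨T, hT⟩ i hi)⟩)
  exact ⟨x₀, ψ, fun i u hu => hKC i (hψ i ⟨u, hu, rfl⟩), hdet⟩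

end QuantitativeHelly

section EllipsoidLift

theorem IsEllipsoid.convex {d : ℕ} {E : Set (EuclideanSpace ℝ (Fin d))} (hE : IsEllipsoid E) :
    Convex ℝ E := by
  obtain ⟨L, rfl⟩ := hE
  exact (convex_closedBall 0 1).affine_image L.toAffineMap

theorem IsEllipsoid.isCompact {d : ℕ} {E : Set (EuclideanSpace ℝ (Fin d))} (hE : IsEllipsoid E) :
    IsCompact E := by
  obtain ⟨L, rfl⟩ := hE
  exact (isCompact_closedBall 0 1).image
    L.toAffineMap.continuous_of_finiteDimensional

/-- An affine image of the unit ball contains ellipsoids of every smaller positive volume. -/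
theorem exists_isEllipsoid_subset_image {d : ℕ} (hd : 1 ≤ d) (x : EuclideanSpace ℝ (Fin d))
    (φ : EuclideanSpace ℝ (Fin d) →ₗ[ℝ] EuclideanSpace ℝ (Fin d)) {v : ℝ} (hv : 0 < v)
    (hle : v ≤ |LinearMap.det φ| *
      (volume (Metric.closedBall (0 : EuclideanSpace ℝ (Fin d)) 1)).toReal) :
    ∃ E, IsEllipsoid E ∧ volume E = ENNReal.ofReal v ∧
      E ⊆ (fun u => x + φ u) '' Metric.closedBall 0 1 := by
  have hω : volume (Metric.closedBall (0 : EuclideanSpace ℝ (Fin d)) 1) ≠ ⊤ :=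
    measure_closedBall_lt_top.ne
  set ω := (volume (Metric.closedBall (0 : EuclideanSpace ℝ (Fin d)) 1)).toReal with hωdef
  have hpos : 0 < |LinearMap.det φ| * ω := hv.trans_le hle
  have hd0 : d ≠ 0 := by omega
  set s : ℝ := (v / (|LinearMap.det φ| * ω)) ^ ((d : ℝ)⁻¹) with hs
  have hs0 : 0 < s := by positivity
  have hs1 : s ≤ 1 := Real.rpow_le_one (by positivity) ((div_le_one hpos).2 hle) (by positivity)
  have hsd : s ^ d = v / (|LinearMap.det φ| * ω) :=
    Real.rpow_inv_natCast_pow (by positivity) hd0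
  have hdet : LinearMap.det (s • φ) = s ^ d * LinearMap.det φ := by
    rw [LinearMap.det_smul, finrank_euclideanSpace_fin]
  have hφ0 : LinearMap.det φ ≠ 0 := fun h => by simp [h] at hpos
  have hdet0 : LinearMap.det (s • φ) ≠ 0 := by
    rw [hdet]
    positivity
  let L := ((s • φ).equivOfDetNeZero hdet0).toAffineEquiv.trans (AffineEquiv.constVAdd ℝ _ x)
  have hL : ∀ u, L u = x + s • φ u := fun u => rfl
  refine ⟨L '' Metric.closedBall 0 1, ⟨L, rfl⟩, ?_, ?_⟩
  · have himage : L '' Metric.closedBall 0 1 =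
        (fun y => x + y) '' ((s • φ) '' Metric.closedBall 0 1) := by
      rw [Set.image_image]
      rfl
    rw [himage, Set.image_add_left, measure_preimage_add, Measure.addHaar_image_linearMap, hdet,
      abs_mul, abs_of_pos (pow_pos hs0 d), hsd, ← ENNReal.ofReal_toReal hω, ← hωdef,
      ← ENNReal.ofReal_mul (by positivity), mul_assoc, div_mul_cancel₀ _ hpos.ne']
  · rintro _ ⟨u, hu, rfl⟩
    refine ⟨s • u, ?_, by simp [hL]⟩
    rw [mem_closedBall_zero_iff] at hu ⊢
    rw [norm_smul, Real.norm_of_nonneg hs0.le]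
    nlinarith [norm_nonneg u]

/-- The parameter space of the affine maps `u ↦ center z + matrix z *ᵥ u`. -/
abbrev EllipsoidParam (d : ℕ) : Type := EuclideanSpace ℝ (Option (Fin d) × Fin d)

/-- The centre of the body parametrized by `z`, stored in the entries indexed by `none`. -/
def EllipsoidParam.center {d : ℕ} : EllipsoidParam d →ₗ[ℝ] EuclideanSpace ℝ (Fin d) where
  toFun z := WithLp.toLp 2 fun i => z (none, i)
  map_add' _ _ := rfl
  map_smul' _ _ := rfl

/-- The matrix of the affine map parametrized by `z`. -/
def EllipsoidParam.matrix {d : ℕ} : EllipsoidParam d →ₗ[ℝ] Matrix (Fin d) (Fin d) ℝ where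
  toFun z := Matrix.of fun i j => z (some i, j)
  map_add' _ _ := rfl
  map_smul' _ _ := rfl

/-- The affine image of the unit ball parametrized by `z`. -/
def EllipsoidParam.body {d : ℕ} (z : EllipsoidParam d) : Set (EuclideanSpace ℝ (Fin d)) :=
  (fun u => center z + (matrix z).toEuclideanLin u) '' Metric.closedBall 0 1

/-- Lower triangular affine images of the unit ball which lie in `C` and have determinant
at least `δ`. -/
def ellipsoidLift {d : ℕ} (δ : ℝ) (C : Set (EuclideanSpace ℝ (Fin d))) :
    Set (EllipsoidParam d) :=
  {z | z.matrix.IsLowerTriangular ∧ (∀ j, 0 < z.matrix j j) ∧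
    Real.log δ ≤ ∑ j, Real.log (z.matrix j j) ∧ z.body ⊆ C}

theorem convex_ellipsoidLift {d : ℕ} (δ : ℝ) {C : Set (EuclideanSpace ℝ (Fin d))}
    (hC : Convex ℝ C) : Convex ℝ (ellipsoidLift δ C) := by
  rintro y ⟨hy1, hy2, hy3, hy4⟩ z ⟨hz1, hz2, hz3, hz4⟩ a b ha hb hab
  have hm : ∀ i j, (EllipsoidParam.matrix (a • y + b • z)) i j =
      a * EllipsoidParam.matrix y i j + b * EllipsoidParam.matrix z i j := fun i j => by
    simp
  refine ⟨fun i j hij => ?_, fun j => ?_, ?_, ?_⟩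
  · rw [hm, hy1 hij, hz1 hij]
    simp
  · rw [hm]
    exact (convex_Ioi (0 : ℝ)) (hy2 j) (hz2 j) ha hb hab
  · calc Real.log δ = a * Real.log δ + b * Real.log δ := by rw [← add_mul, hab, one_mul]
      _ ≤ a * ∑ j, Real.log (EllipsoidParam.matrix y j j) +
          b * ∑ j, Real.log (EllipsoidParam.matrix z j j) := by gcongr
      _ ≤ _ := by
        rw [Finset.mul_sum, Finset.mul_sum, ← Finset.sum_add_distrib]
        refine Finset.sum_le_sum fun j _ => ?_
        rw [hm]
        exact strictConcaveOn_log_Ioi.concaveOn.2 (hy2 j) (hz2 j) ha hb hab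
  · rintro _ ⟨u, hu, rfl⟩
    have := hC (hy4 ⟨u, hu, rfl⟩) (hz4 ⟨u, hu, rfl⟩) ha hb hab
    convert this using 1
    simp only [map_add, map_smul, LinearMap.add_apply, LinearMap.smul_apply]
    module

theorem le_det_of_mem_ellipsoidLift {d : ℕ} {δ : ℝ} (hδ : 0 < δ)
    {C : Set (EuclideanSpace ℝ (Fin d))} {z : EllipsoidParam d} (hz : z ∈ ellipsoidLift δ C) :
    δ ≤ z.matrix.det := by
  obtain ⟨h1, h2, h3, -⟩ := hz
  rw [Matrix.det_of_isLowerTriangular _ h1]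
  rw [← Real.log_prod fun j _ => (h2 j).ne'] at h3
  exact (Real.log_le_log_iff hδ (Finset.prod_pos fun j _ => h2 j)).1 h3

/-- Every ellipsoid centred at the origin is the image of the unit ball under a lower triangular
matrix with positive diagonal. -/
theorem exists_lowerTriangular {d : ℕ}
    (ψ : EuclideanSpace ℝ (Fin d) ≃ₗ[ℝ] EuclideanSpace ℝ (Fin d)) :
    ∃ U : Matrix (Fin d) (Fin d) ℝ, U.IsLowerTriangular ∧ (∀ j, 0 < U j j) ∧
      U.det = |LinearMap.det (ψ : EuclideanSpace ℝ (Fin d) →ₗ[ℝ] EuclideanSpace ℝ (Fin d))| ∧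
      ∀ u, ∃ u', ‖u'‖ = ‖u‖ ∧ U.toEuclideanLin u = ψ u' := by
  let φ : EuclideanSpace ℝ (Fin d) →ₗ[ℝ] EuclideanSpace ℝ (Fin d) := ψ.toLinearMap
  let e := EuclideanSpace.basisFun (Fin d) ℝ
  let f : Fin d → EuclideanSpace ℝ (Fin d) := fun i => LinearMap.adjoint φ (e i)
  have hker : LinearMap.ker (LinearMap.adjoint φ) = ⊥ := by
    rw [LinearMap.ker_eq_bot']
    intro x hx
    have h := LinearMap.adjoint_inner_left φ (ψ.symm x) x
    rw [hx, inner_zero_left] at h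
    have h0 : ‖x‖ ^ 2 = 0 := by simpa [φ, eq_comm] using h
    simpa using h0
  have hf : LinearIndependent ℝ f := by
    have := e.toBasis.linearIndependent.map' _ hker
    simpa [f, Function.comp_def] using this
  have hfin : Module.finrank ℝ (EuclideanSpace ℝ (Fin d)) = Fintype.card (Fin d) := by simp
  let q := InnerProductSpace.gramSchmidtOrthonormalBasis hfin f
  let U : Matrix (Fin d) (Fin d) ℝ := Matrix.of fun i j => inner ℝ (f i) (q j)
  have hU : ∀ u, U.toEuclideanLin u = ψ (q.repr.symm u) := by
    intro u
    ext i
    have h1 : ψ (q.repr.symm u) = ∑ j, u j • ψ (q j) := by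
      rw [← OrthonormalBasis.sum_repr_symm]
      simp
    have h2 : ∀ j, U i j = ψ (q j) i := by
      intro j
      have := LinearMap.adjoint_inner_left φ (q j) (e i)
      simp only [U, f, Matrix.of_apply, this]
      simp [e, φ, EuclideanSpace.inner_single_left]
    rw [h1]
    simp [Matrix.toLpLin_apply, Matrix.mulVec, dotProduct, h2, mul_comm]
  have htri : U.IsLowerTriangular := fun i j hij => by
    have := InnerProductSpace.gramSchmidtOrthonormalBasis_inv_triangular hfin f
      (i := i) (j := j) hij
    simpa [U, q, real_inner_comm] using this
  have hdiag : ∀ j, 0 < U j j := by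
    intro j
    have hg := InnerProductSpace.gramSchmidt_ne_zero j hf
    have hn : InnerProductSpace.gramSchmidtNormed ℝ f j ≠ 0 := fun h => by
      have := InnerProductSpace.gramSchmidtNormed_unit_length j hf
      simp [h] at this
    have h1 : inner ℝ (f j) (InnerProductSpace.gramSchmidt ℝ f j) =
        ‖InnerProductSpace.gramSchmidt ℝ f j‖ ^ 2 := by
      conv_lhs => rw [InnerProductSpace.gramSchmidt_def'' ℝ f j]
      rw [inner_add_left, sum_inner, Finset.sum_eq_zero, add_zero, real_inner_self_eq_norm_sq]
      intro i hi
      rw [inner_smul_left, InnerProductSpace.gramSchmidt_orthogonal ℝ f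
        (Finset.mem_Iio.1 hi).ne, mul_zero]
    have h2 : U j j = ‖InnerProductSpace.gramSchmidt ℝ f j‖⁻¹ *
        ‖InnerProductSpace.gramSchmidt ℝ f j‖ ^ 2 := by
      simp only [U, q, Matrix.of_apply,
        InnerProductSpace.gramSchmidtOrthonormalBasis_apply hfin hn,
        InnerProductSpace.gramSchmidtNormed, real_inner_smul_right, h1]
      simp
    rw [h2]
    have := norm_pos_iff.2 hg
    positivity
  have hdet : U.det = |LinearMap.det φ| := by
    have hpos : 0 < U.det := by
      rw [Matrix.det_of_isLowerTriangular _ htri]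
      exact Finset.prod_pos fun j _ => hdiag j
    have hcomp : U.toEuclideanLin = φ ∘ₗ q.repr.symm.toLinearIsometry.toLinearMap :=
      LinearMap.ext hU
    have hq : |LinearMap.det q.repr.symm.toLinearIsometry.toLinearMap| = 1 := by
      rw [← Real.norm_eq_abs, ← LinearMap.normDet_eq_norm_det, LinearIsometry.normDet_eq_one]
    rw [← abs_of_pos hpos, ← det_toEuclideanLin, hcomp, LinearMap.det_comp, abs_mul, hq, mul_one]
  exact ⟨U, htri, hdiag, hdet, fun u => ⟨_, q.repr.symm.norm_map u, hU u⟩⟩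

theorem exists_mem_ellipsoidLift {d : ℕ} {δ : ℝ} (hδ : 0 < δ) (x : EuclideanSpace ℝ (Fin d))
    (ψ : EuclideanSpace ℝ (Fin d) ≃ₗ[ℝ] EuclideanSpace ℝ (Fin d))
    (hψ : δ ≤ |LinearMap.det (ψ : EuclideanSpace ℝ (Fin d) →ₗ[ℝ] EuclideanSpace ℝ (Fin d))|) :
    ∃ z, ∀ C, (∀ u ∈ Metric.closedBall 0 1, x + ψ u ∈ C) → z ∈ ellipsoidLift δ C := by
  obtain ⟨U, hU, hpos, hdet, hψU⟩ := exists_lowerTriangular ψ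
  let z : EllipsoidParam d := WithLp.toLp 2 fun k => k.1.elim (x k.2) fun i => U i k.2
  have hc : z.center = x := rfl
  have hm : z.matrix = U := rfl
  refine ⟨z, fun C hC => ⟨hm ▸ hU, hm ▸ hpos, ?_, ?_⟩⟩
  · rw [hm, ← Real.log_prod fun j _ => (hpos j).ne', ← Matrix.det_of_isLowerTriangular _ hU, hdet]
    exact Real.log_le_log hδ hψ
  · rintro _ ⟨u, hu, rfl⟩
    obtain ⟨u', hu', h⟩ := hψU u
    simp only [hc, hm, h]
    exact hC u' (by simpa [hu'] using hu)

theorem inv_pow_le_volume_closedBall {d : ℕ} (hd : 1 ≤ d) :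
    ((d : ℝ)⁻¹) ^ d ≤ (volume (Metric.closedBall (0 : EuclideanSpace ℝ (Fin d)) 1)).toReal := by
  have hd0 : (0 : ℝ) < d := by exact_mod_cast hd
  have hsub : WithLp.ofLp ⁻¹' Set.Icc (0 : Fin d → ℝ) (fun _ => (d : ℝ)⁻¹) ⊆
      Metric.closedBall (0 : EuclideanSpace ℝ (Fin d)) 1 := by
    rintro x ⟨hx0, hx1⟩
    rw [mem_closedBall_zero_iff, EuclideanSpace.norm_eq, Real.sqrt_le_one]
    calc ∑ i, ‖x i‖ ^ 2 ≤ ∑ _i : Fin d, (d : ℝ)⁻¹ := by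
          refine Finset.sum_le_sum fun i _ => ?_
          have h0 : 0 ≤ x i := hx0 i
          have h1 : x i ≤ (d : ℝ)⁻¹ := hx1 i
          have h2 : (d : ℝ)⁻¹ ≤ 1 := inv_le_one_of_one_le₀ (by exact_mod_cast hd)
          rw [Real.norm_of_nonneg h0]
          nlinarith
      _ = 1 := by simp [hd0.ne']
  have hvol : volume (WithLp.ofLp ⁻¹' Set.Icc (0 : Fin d → ℝ) (fun _ => (d : ℝ)⁻¹) :
      Set (EuclideanSpace ℝ (Fin d))) = ENNReal.ofReal (((d : ℝ)⁻¹) ^ d) := by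
    rw [(PiLp.volume_preserving_ofLp (Fin d)).measure_preimage
      measurableSet_Icc.nullMeasurableSet, Real.volume_Icc_pi]
    simp [← ENNReal.ofReal_pow, hd0.le]
  rw [← ENNReal.ofReal_le_iff_le_toReal measure_closedBall_lt_top.ne, ← hvol]
  exact measure_mono hsub

theorem transversal_volume_le {d : ℕ} (hd : 1 ≤ d) :
    (1 / 2 : ℝ) ^ (d ^ 2) * (d : ℝ) ^ (-(5 * (d : ℝ) ^ 2 / 2) + (d : ℝ)) ≤
      ((2 * (d : ℝ) ^ 3)⁻¹) ^ d * ((d : ℝ)⁻¹) ^ d := by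
  have hd1 : (1 : ℝ) ≤ d := by exact_mod_cast hd
  have hd0 : (0 : ℝ) < d := by positivity
  have hrhs : ((2 * (d : ℝ) ^ 3)⁻¹) ^ d * ((d : ℝ)⁻¹) ^ d =
      (1 / 2) ^ d * (d : ℝ) ^ (-(4 * (d : ℝ))) := by
    rw [Real.rpow_neg hd0.le, show 4 * (d : ℝ) = ((4 * d : ℕ) : ℝ) by push_cast; ring,
      Real.rpow_natCast, pow_mul, ← inv_pow, ← mul_pow, ← mul_pow]
    congr 1
    field_simp
  rw [hrhs]
  refine mul_le_mul (pow_le_pow_of_le_one (by norm_num) (by norm_num) (by nlinarith)) ?_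
    (by positivity) (by positivity)
  rcases hd.eq_or_lt with rfl | hd2
  · simp
  · have : (2 : ℝ) ≤ d := by exact_mod_cast hd2
    exact Real.rpow_le_rpow_of_exponent_le hd1 (by nlinarith)

end EllipsoidLift

/-- Quantitative (p,q)-Theorem with a small lower bound on p. -/
theorem quantitative_pq_small_p :
    ∃ c : ℝ, 0 < c ∧
      ∀ d : ℕ, 1 ≤ d →
        ∀ p : ℕ, 3 * d + 1 ≤ p →
          ∃ H : ℕ,
            ∀ n : ℕ, ∀ C : Fin n → Set (EuclideanSpace ℝ (Fin d)),
              (∀ i, Convex ℝ (C i)) →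
              (∀ i, ∃ E, IsEllipsoid E ∧ volume E = 1 ∧ E ⊆ C i) →
              (∀ S : Finset (Fin n), S.card = p →
                ∃ T ⊆ S, T.card = 3 * d + 1 ∧
                  ∃ E, IsEllipsoid E ∧ volume E = 1 ∧ E ⊆ ⋂ i ∈ T, C i) →
              ∃ T : Finset (Set (EuclideanSpace ℝ (Fin d))),
                T.card ≤ H ∧
                (∀ E ∈ T, IsEllipsoid E ∧
                  volume E = ENNReal.ofReal
                    (c ^ (d ^ 2) *
                      (d : ℝ) ^ (-(5 * (d : ℝ) ^ 2 / 2) + (d : ℝ)))) ∧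
                ∀ i, ∃ E ∈ T, E ⊆ C i := by
  classical
  refine ⟨1 / 2, by norm_num, fun d hd p _ => ?_⟩
  let δ : ℝ := ((2 * (d : ℝ) ^ 3)⁻¹) ^ d
  have hd0 : (0 : ℝ) < d := by exact_mod_cast hd
  have hδ : 0 < δ := by positivity
  let D := Module.finrank ℝ (EllipsoidParam d)
  let a := max (D + 1) (3 * d + 1)
  obtain ⟨N, hN⟩ := exists_homogeneous_subset.{0} (3 * d + 1) a (p * (3 * d + 1))
  obtain ⟨H, hH⟩ := pq_theorem (E := EllipsoidParam d) N
  refine ⟨H, fun n C hC hunit hpq => ?_⟩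
  let R : Finset (Fin n) → Prop := fun T =>
    ∃ E, IsEllipsoid E ∧ volume E = 1 ∧ E ⊆ ⋂ i ∈ T, C i
  have hR₁ : ∀ i, R {i} := fun i => by simpa [R] using hunit i
  have hlift : ∀ f : Fin N → Fin n, ∃ S : Finset (Fin N), S.card = D + 1 ∧
      (⋂ j ∈ S, ellipsoidLift δ (C (f j))).Nonempty := by
    intro f
    obtain ⟨S, -, hSa, hS⟩ | ⟨S, -, hSb, hS⟩ :=
      hN Finset.univ (by simp) fun T => R (T.image f)
    · have hSd : 3 * d + 1 ≤ S.card := hSa ▸ le_max_right _ _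
      have : Nonempty S := (Finset.card_pos.1 (by omega)).to_subtype
      obtain ⟨x, ψ, hψ, hdet⟩ := quantitative_helly hd (C := fun j : S => C (f j))
        (fun j => hC _) fun T hT => by
          obtain ⟨T', hTT', hT'S, hT'⟩ := Finset.exists_subsuperset_card_eq
            (s := T.map (Function.Embedding.subtype _)) (t := S) (n := 3 * d + 1)
            (Finset.map_subtype_subset T) (by rw [Finset.card_map]; omega) hSd
          obtain ⟨E, hE, hE1, hEC⟩ := hS T' hT'S hT'
          refine ⟨E, hE.convex, hE.isCompact, hE1.ge, fun j hj => hEC.trans ?_⟩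
          exact Set.biInter_subset_of_mem (Finset.mem_image_of_mem f
            (hTT' (Finset.mem_map_of_mem (Function.Embedding.subtype _) hj)))
      obtain ⟨z, hz⟩ := exists_mem_ellipsoidLift hδ x ψ hdet
      obtain ⟨S', hS', hS'D⟩ := Finset.exists_subset_card_eq
        ((le_max_left (D + 1) (3 * d + 1)).trans hSa.ge)
      exact ⟨S', hS'D, z, Set.mem_iInter₂.2 fun j hj => hz _ (hψ ⟨j, hS' hj⟩)⟩
    · obtain ⟨T, hTS, hT, hRT⟩ := exists_subset_card_eq_image f (by omega) hR₁ hpq hSb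
      exact absurd hRT (hS T hTS hT)
  obtain ⟨T, hTH, hT⟩ := hH (fun i => ellipsoidLift δ (C i))
    (fun i => convex_ellipsoidLift δ (hC i)) hlift
  let v : ℝ := (1 / 2) ^ (d ^ 2) * (d : ℝ) ^ (-(5 * (d : ℝ) ^ 2 / 2) + (d : ℝ))
  have hell : ∀ z ∈ T.filter (δ ≤ ·.matrix.det), ∃ E, IsEllipsoid E ∧
      volume E = ENNReal.ofReal v ∧ E ⊆ z.body := fun z hz =>
    exists_isEllipsoid_subset_image hd _ _ (by positivity) <| by
      rw [det_toEuclideanLin]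
      exact (transversal_volume_le hd).trans (mul_le_mul
        ((Finset.mem_filter.1 hz).2.trans (le_abs_self _)) (inv_pow_le_volume_closedBall hd)
        (by positivity) (abs_nonneg _))
  choose! F hF hFv hFz using hell
  refine ⟨(T.filter (δ ≤ ·.matrix.det)).image F,
    Finset.card_image_le.trans ((Finset.card_filter_le _ _).trans hTH), ?_, fun i => ?_⟩
  · simp only [Finset.forall_mem_image]
    exact fun z hz => ⟨hF z hz, hFv z hz⟩
  · obtain ⟨z, hzT, hz⟩ := hT i
    have hzδ : z ∈ T.filter (δ ≤ ·.matrix.det) :=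
      Finset.mem_filter.2 ⟨hzT, le_det_of_mem_ellipsoidLift hδ hz⟩
    exact ⟨F z, Finset.mem_image_of_mem F hzδ, (hFz z hzδ).trans hz.2.2.2⟩
end

section
/- Let C be a convex set in ℝ^d such that the origin-centered closed Euclidean unit ball B^d is contained in C and every ellipsoid contained in C has volume at most the volume of B^d (i.e., B^d is a largest-volume ellipsoid contained in C). Let E be an ellipsoid contained in C of volume at least δ · vol(B^d), where 0 < δ < 1. Then there exists a vector t ∈ ℝ^d such that the translate (δ/d^(d−1))·B^d + t is contained in E. -/
open MeasureTheory

open Module in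
/-- A consequence of Hadamard's inequality: a lower bound for the expansion of a linear map in terms
of its determinant and an upper bound for its operator norm. -/
theorem LinearMap.abs_det_mul_norm_le {V : Type*} [NormedAddCommGroup V] [InnerProductSpace ℝ V]
    [FiniteDimensional ℝ V] {M : ℝ} (f : V →ₗ[ℝ] V) (hf : ∀ v, ‖f v‖ ≤ M * ‖v‖) (v : V) :
    |LinearMap.det f| * ‖v‖ ≤ M ^ (finrank ℝ V - 1) * ‖f v‖ := by
  rcases eq_or_ne v 0 with rfl | hv
  · simp
  have : Nontrivial V := ⟨v, 0, hv⟩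
  obtain ⟨n, hn⟩ := Nat.exists_eq_succ_of_ne_zero (finrank_pos (R := ℝ) (M := V)).ne'
  have : Fact (finrank ℝ V = n + 1) := ⟨hn⟩
  have hv' : 0 < ‖v‖ := norm_pos_iff.2 hv
  obtain ⟨b, hb⟩ := Orthonormal.exists_orthonormalBasis_extension_of_card_eq
    (ι := Fin (n + 1)) (𝕜 := ℝ) (by simp [hn]) (v := fun _ => ‖v‖⁻¹ • v) (s := {0})
    ⟨fun i => by simp [norm_smul, hv'.ne'], fun i j hij => (hij (Subsingleton.elim _ _)).elim⟩
  have hb0 : b 0 = ‖v‖⁻¹ • v := hb 0 rfl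
  have hdet : b.toBasis.orientation.volumeForm (f ∘ b) = LinearMap.det f := by
    rw [Orientation.volumeForm_robust _ b rfl, Basis.det_comp, ← b.coe_toBasis, Basis.det_self,
      mul_one]
  have h := b.toBasis.orientation.abs_volumeForm_apply_le (f ∘ b)
  rw [hdet, Fin.prod_univ_succ] at h
  have hprod : ∏ i : Fin n, ‖(f ∘ b) i.succ‖ ≤ M ^ n := by
    calc _ ≤ ∏ _i : Fin n, M :=
          Finset.prod_le_prod (fun _ _ => norm_nonneg _) fun i _ => by
            simpa using hf (b i.succ)
      _ = M ^ n := by simp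
  have h' : |LinearMap.det f| ≤ ‖v‖⁻¹ * ‖f v‖ * M ^ n := by
    refine h.trans ?_
    simp only [Function.comp_apply, hb0, map_smul, norm_smul, norm_inv, norm_norm] at hprod ⊢
    gcongr
  rw [hn, Nat.succ_sub_one]
  calc _ ≤ ‖v‖⁻¹ * ‖f v‖ * M ^ n * ‖v‖ := by gcongr
    _ = _ := by field_simp

/-- An ellipsoid inscribed in the convex hull of the unit ball and a point `R • e`. -/
theorem Convex.stretched_ball_subset {V : Type*} [NormedAddCommGroup V] [InnerProductSpace ℝ V]
    {C : Set V} (hC : Convex ℝ C) (hBC : Metric.closedBall 0 1 ⊆ C) {e : V} (he : ‖e‖ = 1)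
    {R c b : ℝ} (hR : R • e ∈ C) (hc0 : 0 ≤ c) (hc : c < 1 / 2) (hb : b ^ 2 = 1 - 2 * c)
    {w : V} (hw : ‖w‖ ≤ 1) :
    (c * (R - 1)) • e + (b • w + ((1 + c * (R - 1) - b) * inner ℝ e w) • e) ∈ C := by
  set y := inner ℝ e w with hy
  obtain ⟨hy1, hy2⟩ : -1 ≤ y ∧ y ≤ 1 := abs_le.1 <| by
    simpa [he] using (abs_real_inner_le_norm e w).trans (by simpa [he] using hw)
  set l := c * (1 + y) with hl
  have hl0 : 0 ≤ l := mul_nonneg hc0 (by linarith)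
  have hl1 : 0 < 1 - l := by nlinarith
  have hq : ‖(y - l - b * y) • e + b • w‖ ≤ 1 - l := by
    refine abs_le_of_sq_le_sq' ?_ hl1.le |>.2
    rw [norm_add_sq_real, norm_smul, norm_smul, inner_smul_left, inner_smul_right, he, ← hy,
      mul_pow, mul_pow, Real.norm_eq_abs, Real.norm_eq_abs, sq_abs, sq_abs, hb]
    have hw2 : ‖w‖ ^ 2 ≤ 1 := pow_le_one₀ (norm_nonneg w) hw
    have : (1 - 2 * c) * ‖w‖ ^ 2 ≤ (1 - 2 * c) * 1 := by gcongr; linarith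
    simp only [conj_trivial]
    have h2 : (y - l - b * y) ^ 2 * 1 ^ 2 + 2 * ((y - l - b * y) * (b * y)) + (1 - 2 * c)
        = (1 - l) ^ 2 := by
      rw [hl]; linear_combination (-y ^ 2) * hb
    linarith
  have hqC : (1 - l)⁻¹ • ((y - l - b * y) • e + b • w) ∈ C := hBC <| by
    rw [mem_closedBall_zero_iff, norm_smul, norm_inv, Real.norm_of_nonneg hl1.le]
    exact (inv_mul_le_one₀ hl1).2 hq
  convert hC hR hqC hl0 hl1.le (by ring) using 1
  rw [smul_inv_smul₀ hl1.ne', hl]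
  module

theorem exists_one_lt_mul_pow {R : ℝ} {d : ℕ} (hd : 1 ≤ d) (hR : d < R) :
    ∃ c : ℝ, 0 ≤ c ∧ c < 1 / 2 ∧
      1 < (1 + c * (R - 1)) ^ 2 * (1 - 2 * c) ^ (d - 1) := by
  have hd' : (1 : ℝ) ≤ d := by exact_mod_cast hd
  have hRd : 0 < R * d := by nlinarith
  refine ⟨(R - d) / (4 * (R * d)), by have := sub_pos.2 hR; positivity, ?_, ?_⟩
  · rw [div_lt_iff₀ (by positivity)]; nlinarith
  set c := (R - d) / (4 * (R * d)) with hc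
  have hc0 : 0 < c := by have := sub_pos.2 hR; positivity
  have hcR : c * (4 * (R * d)) = R - d := div_mul_cancel₀ _ (by positivity)
  have hc1 : 2 * c < 1 := by
    have : c < 1 / 2 := by rw [hc, div_lt_iff₀ (by positivity)]; nlinarith
    linarith
  have h1 := one_add_mul_le_pow (a := -(2 * c)) (by linarith) (d - 1)
  rw [Nat.cast_sub hd, Nat.cast_one, ← sub_eq_add_neg] at h1
  have hRp : 0 ≤ c * (R - 1) := mul_nonneg hc0.le (by linarith)
  calc 1 < (1 + 2 * (c * (R - 1))) * (1 + (d - 1) * -(2 * c)) := by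
        have : 0 < c * (R - d - 2 * c * ((R - 1) * (d - 1))) := by
          refine mul_pos hc0 ?_
          have : c * ((R - 1) * (d - 1)) ≤ c * (R * d) := by gcongr <;> linarith
          linarith
        linarith
    _ ≤ (1 + 2 * (c * (R - 1))) * (1 - 2 * c) ^ (d - 1) := by gcongr
    _ ≤ _ := by
        have : 0 ≤ 1 - 2 * c := by linarith
        gcongr
        nlinarith [sq_nonneg (c * (R - 1))]

theorem isEllipsoid_image_linearMap_add {d : ℕ}
    {f : EuclideanSpace ℝ (Fin d) →ₗ[ℝ] EuclideanSpace ℝ (Fin d)} (hf : LinearMap.det f ≠ 0)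
    (z : EuclideanSpace ℝ (Fin d)) :
    IsEllipsoid ((fun w => z + f w) '' Metric.closedBall 0 1) :=
  ⟨(f.equivOfDetNeZero hf).toAffineEquiv.trans (AffineEquiv.constVAdd ℝ _ z), rfl⟩

theorem volume_image_linearMap_add {d : ℕ}
    (f : EuclideanSpace ℝ (Fin d) →ₗ[ℝ] EuclideanSpace ℝ (Fin d))
    (z : EuclideanSpace ℝ (Fin d)) (s : Set (EuclideanSpace ℝ (Fin d))) :
    volume ((fun w => z + f w) '' s) = ENNReal.ofReal |LinearMap.det f| * volume s := by
  rw [← Measure.addHaar_image_linearMap, ← Set.image_image (z + ·) f, Set.image_add_left,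
    measure_preimage_add]

/-- The outer inclusion of John's theorem: if the unit ball is a largest-volume ellipsoid in a
convex set `C`, then `C` lies in the ball of radius `d`. -/
theorem norm_le_of_closedBall_largest_ellipsoid {d : ℕ} (hd : 1 ≤ d)
    {C : Set (EuclideanSpace ℝ (Fin d))} (hC : Convex ℝ C)
    (hBC : Metric.closedBall (0 : EuclideanSpace ℝ (Fin d)) 1 ⊆ C)
    (hmax : ∀ E : Set (EuclideanSpace ℝ (Fin d)), IsEllipsoid E → E ⊆ C →
      volume E ≤ volume (Metric.closedBall (0 : EuclideanSpace ℝ (Fin d)) 1))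
    {x : EuclideanSpace ℝ (Fin d)} (hx : x ∈ C) : ‖x‖ ≤ d := by
  by_contra! hR
  set R := ‖x‖ with hRx
  have hR0 : 0 < R := (Nat.cast_nonneg d).trans_lt hR
  have hR1 : 1 ≤ R := hR.le.trans' (by exact_mod_cast hd)
  obtain ⟨c, hc0, hc, hprod⟩ := exists_one_lt_mul_pow hd hR
  set b := √(1 - 2 * c) with hb
  have hb0 : 0 < b := Real.sqrt_pos.2 (by linarith)
  have hb2 : b ^ 2 = 1 - 2 * c := Real.sq_sqrt (by linarith)
  set a := 1 + c * (R - 1) with ha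
  have ha0 : 0 < a := by have := mul_nonneg hc0 (sub_nonneg.2 hR1); linarith
  set e := R⁻¹ • x with he
  have he1 : ‖e‖ = 1 := by rw [he, norm_smul, norm_inv, norm_norm, inv_mul_cancel₀ hR0.ne']
  have hRe : R • e = x := smul_inv_smul₀ hR0.ne' x
  let f : EuclideanSpace ℝ (Fin d) →ₗ[ℝ] EuclideanSpace ℝ (Fin d) :=
    b • LinearMap.transvection (innerₗ _ e) (((a - b) / b) • e)
  have hfw (w) : f w = b • w + ((a - b) * inner ℝ e w) • e := by
    simp only [f, LinearMap.smul_apply, LinearMap.transvection.apply, innerₗ_apply_apply, smul_add,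
      smul_smul]
    congr 2
    field_simp
  have hdet : LinearMap.det f = b ^ (d - 1) * a := by
    obtain ⟨n, rfl⟩ := Nat.exists_eq_add_of_le' hd
    simp only [f, LinearMap.det_smul, LinearMap.transvection.det, finrank_euclideanSpace,
      Fintype.card_fin, innerₗ_apply_apply, inner_smul_right, real_inner_self_eq_norm_sq, he1,
      Nat.add_sub_cancel]
    field_simp
    ring
  have hdet1 : 1 < LinearMap.det f := by
    rw [hdet]
    refine lt_of_pow_lt_pow_left₀ 2 (by positivity) ?_
    rw [mul_pow, ← pow_mul, mul_comm (d - 1), pow_mul, hb2]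
    linarith
  have hle := hmax _ (isEllipsoid_image_linearMap_add (f := f) (by linarith) ((c * (R - 1)) • e))
    (by
      rintro _ ⟨w, hw, rfl⟩
      simp only [hfw]
      exact hC.stretched_ball_subset hBC he1 (hRe ▸ hx) hc0 hc hb2 (by simpa using hw))
  rw [volume_image_linearMap_add] at hle
  have hpos : 0 < volume (Metric.closedBall (0 : EuclideanSpace ℝ (Fin d)) 1) :=
    Metric.measure_closedBall_pos _ _ one_pos
  have hfin : volume (Metric.closedBall (0 : EuclideanSpace ℝ (Fin d)) 1) ≠ ⊤ :=
    measure_closedBall_lt_top.ne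
  refine absurd hle (not_le.2 ?_)
  conv_lhs => rw [← one_mul (volume _)]
  refine ENNReal.mul_lt_mul_left hpos.ne' hfin ?_
  rw [← ENNReal.ofReal_one]
  exact (ENNReal.ofReal_lt_ofReal_iff (by positivity)).2 (hdet1.trans_le (le_abs_self _))

/-- If the unit ball is a largest-volume ellipsoid in a convex set `C`, then every
ellipsoid in `C` of volume at least `δ·vol(B^d)` contains a translate of
`(δ/d^(d-1))·B^d`. -/
theorem translate_of_scaled_ball_in_ellipsoid
    (d : ℕ) (hd : 1 ≤ d) (C : Set (EuclideanSpace ℝ (Fin d)))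
    (hC : Convex ℝ C)
    (hBC : Metric.closedBall (0 : EuclideanSpace ℝ (Fin d)) 1 ⊆ C)
    (hmax : ∀ E : Set (EuclideanSpace ℝ (Fin d)), IsEllipsoid E → E ⊆ C →
      volume E ≤ volume (Metric.closedBall (0 : EuclideanSpace ℝ (Fin d)) 1))
    (E : Set (EuclideanSpace ℝ (Fin d))) (hE : IsEllipsoid E) (hEC : E ⊆ C)
    (δ : ℝ) (hδ : 0 < δ) (hδ1 : δ < 1)
    (hvol : ENNReal.ofReal δ *
        volume (Metric.closedBall (0 : EuclideanSpace ℝ (Fin d)) 1) ≤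
      volume E) :
    ∃ t : EuclideanSpace ℝ (Fin d),
      (fun x => (δ / (d : ℝ) ^ (d - 1)) • x + t) ''
          Metric.closedBall (0 : EuclideanSpace ℝ (Fin d)) 1 ⊆ E := by
  obtain ⟨L, rfl⟩ := hE
  let f : EuclideanSpace ℝ (Fin d) →ₗ[ℝ] EuclideanSpace ℝ (Fin d) := L.linear
  have hL (w) : L w = L 0 + f w := by
    change L w = L 0 + L.linear w
    simpa [add_comm] using L.map_vadd 0 w
  have hd0 : (0 : ℝ) < d := by exact_mod_cast hd
  have hball (w : EuclideanSpace ℝ (Fin d)) (hw : ‖w‖ ≤ 1) : ‖L w‖ ≤ d :=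
    norm_le_of_closedBall_largest_ellipsoid hd hC hBC hmax (hEC ⟨w, by simpa using hw, rfl⟩)
  have hf1 (w : EuclideanSpace ℝ (Fin d)) (hw : ‖w‖ ≤ 1) : ‖f w‖ ≤ d := by
    have h : (2 : ℝ) • f w = L w - L (-w) := by rw [hL w, hL (-w), map_neg]; module
    have h' := norm_sub_le (L w) (L (-w))
    rw [← h, norm_smul, Real.norm_ofNat] at h'
    linarith [hball w hw, hball (-w) (by simpa using hw)]
  have hfd (w : EuclideanSpace ℝ (Fin d)) : ‖f w‖ ≤ d * ‖w‖ := by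
    rcases eq_or_ne w 0 with rfl | hw
    · simp
    have hw' : 0 < ‖w‖ := norm_pos_iff.2 hw
    have h := hf1 (‖w‖⁻¹ • w) (by simp [norm_smul, hw'.ne'])
    rwa [map_smul, norm_smul, norm_inv, norm_norm, inv_mul_le_iff₀ hw', mul_comm] at h
  have hdet : δ ≤ |LinearMap.det f| := by
    have hLf : (L : EuclideanSpace ℝ (Fin d) → EuclideanSpace ℝ (Fin d)) = fun w => L 0 + f w :=
      funext hL
    rw [hLf, volume_image_linearMap_add] at hvol
    exact (ENNReal.ofReal_le_ofReal_iff (abs_nonneg _)).1 <|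
      (ENNReal.mul_le_mul_iff_left (Metric.measure_closedBall_pos _ _ one_pos).ne'
        measure_closedBall_lt_top.ne).1 hvol
  refine ⟨L 0, ?_⟩
  rintro _ ⟨x, hx, rfl⟩
  rw [mem_closedBall_zero_iff] at hx
  obtain ⟨v, hv⟩ := L.linear.surjective ((δ / (d : ℝ) ^ (d - 1)) • x)
  replace hv : f v = (δ / (d : ℝ) ^ (d - 1)) • x := hv
  refine ⟨v, ?_, by rw [hL, hv, add_comm]⟩
  have h := f.abs_det_mul_norm_le hfd v
  rw [hv, norm_smul, Real.norm_of_nonneg (by positivity), finrank_euclideanSpace_fin, ← mul_assoc,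
    mul_div_cancel₀ _ (by positivity)] at h
  rw [mem_closedBall_zero_iff]
  refine le_of_mul_le_mul_left ?_ hδ
  calc δ * ‖v‖ ≤ |LinearMap.det f| * ‖v‖ := by gcongr
    _ ≤ δ * ‖x‖ := h
    _ ≤ δ * 1 := by gcongr
end
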